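/- Let φ be a monotonic nonessential enhancement of site percolation on the square lattice ℤ² and let s ∈ [0,1]. Then: (i) if lim_{p↓p_c} log θ(p)/log(p−p_c) = β, then lim_{p↓p_c} log θ(p,s)/log(p−p_c) = β; (ii) if lim_{|x|→∞} log τ_{p_c}(x)/log|x| = −η, then lim_{|x|→∞} log τ_{p_c,s}(x)/log|x| = −η; (iii) if for every p ∈ (0,p_c) the correlation length ξ(p) is well-defined and lim_{p↑p_c} log ξ(p)/log(p_c−p) = −ν, then ξ(p,s) is well-defined and lim_{p↑p_c} log ξ(p,s)/log(p_c−p) = −ν; (iv) if lim_{p↑p_c} log χ(p)/log(p_c−p) = −γ, then lim_{p↑p_c} log χ(p,s)/log(p_c−p) = −γ. In other words, the critical exponents β, η, ν, γ, if they exist for the independent process, exist for the enhanced process and have the same numerical values. -/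

import Mathlib

open MeasureTheory Filter Set Topology
open scoped ENNReal

namespace PercEnh

/-- Sites of the lattice (vertex set `ℤ²`). -/
abbrev Site : Type := ℤ × ℤ

/-- A configuration: the set of open sites. -/
abbrev Config : Type := Set Site

/-- Square-lattice (`ℤ²`-) adjacency: `‖x − y‖₁ = 1`. -/
def adjZ2 (x y : Site) : Prop := |x.1 - y.1| + |x.2 - y.2| = 1

/-- Matching (star) adjacency: `x ≠ y` and `‖x − y‖_∞ = 1`. -/
def adjStar (x y : Site) : Prop := x ≠ y ∧ max |x.1 - y.1| |x.2 - y.2| = 1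

/-- Euclidean norm of a site. -/
noncomputable def siteNorm (x : Site) : ℝ := Real.sqrt ((x.1 : ℝ) ^ 2 + (x.2 : ℝ) ^ 2)

/-- Sites in the closed Euclidean ball of radius `r` centred at the origin. -/
def siteBall (r : ℝ) : Set Site := {x | siteNorm x ≤ r}

/-- The shifted configuration `τ_x ω = {y − x : y ∈ ω}`. -/
def shiftConfig (x : Site) (ω : Config) : Config := {y | y + x ∈ ω}

/-- An enhancement function of (finite) range `R₀`: takes values in subsets of
`𝔹₀ = ℤ² ∩ B(R₀)` and depends only on the restriction of the configuration to `𝔹₀`. -/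
def IsEnhancement (R₀ : ℝ) (φ : Config → Config) : Prop :=
  0 ≤ R₀ ∧ (∀ ω, φ ω ⊆ siteBall R₀) ∧
    ∀ ω ω' : Config, ω ∩ siteBall R₀ = ω' ∩ siteBall R₀ → φ ω = φ ω'

/-- A monotonic enhancement function. -/
def Monotonic (φ : Config → Config) : Prop := ∀ ω ω' : Config, ω ⊆ ω' → φ ω ⊆ φ ω'

/-- The translate `φ_x(ω) = x + φ₀(τ_x ω)`. -/
def enhAt (φ : Config → Config) (x : Site) (ω : Config) : Config :=
  (fun z => z + x) '' φ (shiftConfig x ω)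

/-- The enhanced configuration `ω̂(ω, α) = ω ∪ ⋃_{x : α(x)=1} φ_x(ω)`. -/
def enhanced (φ : Config → Config) (ω : Config) (α : Site → Bool) : Config :=
  ω ∪ {y | ∃ x, α x = true ∧ y ∈ enhAt φ x ω}

/-- The fully (deterministically, with `s = 1`) enhanced configuration `ω̃`. -/
def fullyEnhanced (φ : Config → Config) (ω : Config) : Config :=
  ω ∪ {y | ∃ x, y ∈ enhAt φ x ω}

/-- `ω` contains a doubly-infinite self-repelling path (w.r.t. adjacency `adj`):
a two-sided sequence of distinct sites of `ω` in which exactly the consecutive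
pairs are adjacent. -/
def HasDISRPath (adj : Site → Site → Prop) (ω : Config) : Prop :=
  ∃ γ : ℤ → Site, Function.Injective γ ∧ (∀ i, γ i ∈ ω) ∧
    ∀ i j : ℤ, adj (γ i) (γ j) ↔ (j = i + 1 ∨ i = j + 1)

/-- The enhancement is essential: some configuration without a doubly-infinite
self-repelling path acquires one upon enhancement at the origin. -/
def Essential (adj : Site → Site → Prop) (φ : Config → Config) : Prop :=
  ∃ ω : Config, ¬ HasDISRPath adj ω ∧ HasDISRPath adj (ω ∪ φ ω)

/-- A (finite, nonempty) path w.r.t. adjacency `adj`: distinct sites,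
consecutive ones adjacent. -/
def IsPathOn (adj : Site → Site → Prop) (l : List Site) : Prop :=
  l ≠ [] ∧ l.Nodup ∧ l.Chain' adj

/-- `x` and `y` are joined by a path of sites of `ω`. -/
def ConnectedIn (adj : Site → Site → Prop) (ω : Config) (x y : Site) : Prop :=
  ∃ l : List Site, IsPathOn adj l ∧ (∀ z ∈ l, z ∈ ω) ∧
    l.head? = some x ∧ l.getLast? = some y

/-- `x` belongs to an infinite open cluster of `ω`. -/
def InInfiniteCluster (adj : Site → Site → Prop) (ω : Config) (x : Site) : Prop :=
  {y | ConnectedIn adj ω x y}.Infinite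

/-- `ω` contains an infinite open cluster. -/
def HasInfiniteCluster (adj : Site → Site → Prop) (ω : Config) : Prop :=
  ∃ x, InInfiniteCluster adj ω x

/-- The configuration corresponding to `η : Site → Bool`. -/
def toConfig (η : Site → Bool) : Config := {x | η x = true}

/-- A cylinder event. -/
def cylinder (F : Finset Site) (b : Site → Bool) : Set (Site → Bool) :=
  {η | ∀ x ∈ F, η x = b x}

/-- `μ` is the Bernoulli product measure with density `p` of open sites. -/
def IsBernoulli (p : ℝ) (μ : Measure (Site → Bool)) : Prop :=
  IsProbabilityMeasure μ ∧
    ∀ (F : Finset Site) (b : Site → Bool),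
      μ (cylinder F b) = ∏ x ∈ F, ENNReal.ofReal (if b x then p else 1 - p)

/-- The percolation probability `θ`: the probability that the origin lies in an
infinite open cluster. -/
noncomputable def theta (adj : Site → Site → Prop) (μ : Measure (Site → Bool)) : ℝ :=
  (μ {η | InInfiniteCluster adj (toConfig η) 0}).toReal

/-- The percolation probability of the enhanced process (`μ` the law of the
configuration, `ν` the law of the activation variables). -/
noncomputable def thetaEnh (adj : Site → Site → Prop) (φ : Config → Config)
    (μ ν : Measure (Site → Bool)) : ℝ :=
  ((μ.prod ν) {ηα | InInfiniteCluster adj (enhanced φ (toConfig ηα.1) ηα.2) 0}).toReal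

/-- The critical point `p_c = sup {p ∈ [0,1] : θ(p) = 0}` for the family `P`. -/
noncomputable def pcOf (adj : Site → Site → Prop) (P : ℝ → Measure (Site → Bool)) : ℝ :=
  sSup {p | p ∈ Icc (0:ℝ) 1 ∧ theta adj (P p) = 0}

/-- The connectivity function `τ_p(x)`. -/
noncomputable def tau (adj : Site → Site → Prop) (μ : Measure (Site → Bool)) (x : Site) : ℝ :=
  (μ {η | ConnectedIn adj (toConfig η) 0 x}).toReal

/-- The connectivity function `τ_{p,s}(x)` of the enhanced process. -/
noncomputable def tauEnh (adj : Site → Site → Prop) (φ : Config → Config)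
    (μ ν : Measure (Site → Bool)) (x : Site) : ℝ :=
  ((μ.prod ν) {ηα | ConnectedIn adj (enhanced φ (toConfig ηα.1) ηα.2) 0 x}).toReal

/-- The mean cluster size `χ(p) = E_p‖C‖ = ∑_x τ_p(x)`. -/
noncomputable def chi (adj : Site → Site → Prop) (μ : Measure (Site → Bool)) : ℝ≥0∞ :=
  ∑' x : Site, μ {η | ConnectedIn adj (toConfig η) 0 x}

/-- The mean cluster size of the enhanced process. -/
noncomputable def chiEnh (adj : Site → Site → Prop) (φ : Config → Config)
    (μ ν : Measure (Site → Bool)) : ℝ≥0∞ :=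
  ∑' x : Site, (μ.prod ν) {ηα | ConnectedIn adj (enhanced φ (toConfig ηα.1) ηα.2) 0 x}

/-! ### Open clusters as connected components of a graph -/

lemma adjZ2_iff {x y : Site} : adjZ2 x y ↔
    (x.1 = y.1 ∧ (x.2 = y.2 + 1 ∨ y.2 = x.2 + 1)) ∨
      (x.2 = y.2 ∧ (x.1 = y.1 + 1 ∨ y.1 = x.1 + 1)) := by
  unfold adjZ2
  rcases abs_cases (x.1 - y.1) with h | h <;> rcases abs_cases (x.2 - y.2) with h' | h' <;> omega

lemma adjZ2_symm {x y : Site} (h : adjZ2 x y) : adjZ2 y x := by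
  rw [adjZ2_iff] at *; omega

lemma not_adjZ2_self (x : Site) : ¬ adjZ2 x x := by
  rw [adjZ2_iff]; omega

/-- The nearest-neighbour graph on the open sites of `ω`. -/
def siteGraph (ω : Config) : SimpleGraph Site where
  Adj x y := adjZ2 x y ∧ x ∈ ω ∧ y ∈ ω
  symm := ⟨fun _ _ h => ⟨adjZ2_symm h.1, h.2.2, h.2.1⟩⟩
  loopless := ⟨fun x h => not_adjZ2_self x h.1⟩

lemma siteGraph_mono {ω ω' : Config} (h : ω ⊆ ω') : siteGraph ω ≤ siteGraph ω' :=
  fun _ _ hab => ⟨hab.1, h hab.2.1, h hab.2.2⟩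

lemma mem_of_reachable {ω : Config} {x y : Site} (hx : x ∈ ω)
    (h : (siteGraph ω).Reachable x y) : y ∈ ω := by
  rw [SimpleGraph.reachable_iff_reflTransGen] at h
  induction h with
  | refl => exact hx
  | tail _ hbc _ => exact hbc.2.2

lemma reachable_of_isChain {ω : Config} {l : List Site} {x y : Site} (hc : l.IsChain adjZ2)
    (hl : ∀ z ∈ l, z ∈ ω) (hx : l.head? = some x) (hy : l.getLast? = some y) :
    (siteGraph ω).Reachable x y := by
  induction l generalizing x with
  | nil => simp at hx
  | cons a t ih =>
    obtain rfl : a = x := by simpa using hx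
    cases t with
    | nil =>
      obtain rfl : a = y := by simpa using hy
      exact SimpleGraph.Reachable.refl _
    | cons b t =>
      rw [List.isChain_cons_cons] at hc
      have hab : (siteGraph ω).Adj a b := ⟨hc.1, hl _ (by simp), hl _ (by simp)⟩
      exact hab.reachable.trans (ih hc.2 (fun z hz => hl z (List.mem_cons_of_mem _ hz)) rfl
        (by simpa using hy))

lemma connectedIn_iff {ω : Config} {x y : Site} :
    ConnectedIn adjZ2 ω x y ↔ x ∈ ω ∧ (siteGraph ω).Reachable x y := by
  constructor
  · rintro ⟨l, ⟨-, -, hc⟩, hl, hx, hy⟩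
    exact ⟨hl x (List.mem_of_head? hx), reachable_of_isChain hc hl hx hy⟩
  · rintro ⟨hx, ⟨w⟩⟩
    classical
    have hsub : ∀ z ∈ (w.toPath : (siteGraph ω).Walk x y).support, z ∈ ω := fun z hz =>
      mem_of_reachable hx ⟨(w.toPath : (siteGraph ω).Walk x y).takeUntil z hz⟩
    refine ⟨(w.toPath : (siteGraph ω).Walk x y).support, ⟨SimpleGraph.Walk.support_ne_nil _,
      w.toPath.2.support_nodup,
      (SimpleGraph.Walk.isChain_adj_support _).imp fun _ _ h => h.1⟩, hsub, ?_, ?_⟩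
    · rw [List.head?_eq_some_head (SimpleGraph.Walk.support_ne_nil _),
        SimpleGraph.Walk.head_support]
    · rw [List.getLast?_eq_some_getLast (SimpleGraph.Walk.support_ne_nil _),
        SimpleGraph.Walk.getLast_support]

lemma ConnectedIn.mono {ω ω' : Config} (h : ω ⊆ ω') {x y : Site}
    (hxy : ConnectedIn adjZ2 ω x y) : ConnectedIn adjZ2 ω' x y := by
  rw [connectedIn_iff] at *
  exact ⟨h hxy.1, hxy.2.mono (siteGraph_mono h)⟩

/-- A shortest path between two connected sites is self-repelling. -/
lemma exists_geodesic {ω : Config} {x y : Site} (hx : x ∈ ω)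
    (h : (siteGraph ω).Reachable x y) :
    ∃ (n : ℕ) (f : ℕ → Site), f 0 = x ∧ f n = y ∧ (∀ i, f i ∈ ω) ∧
      (∀ i < n, adjZ2 (f i) (f (i + 1))) ∧
      (∀ i j, i ≤ n → j ≤ n → f i = f j → i = j) ∧
      ∀ i j, i ≤ n → j ≤ n → adjZ2 (f i) (f j) → i ≤ j + 1 := by
  obtain ⟨w, hw⟩ := h.exists_walk_length_eq_dist
  have hreach : ∀ i, (siteGraph ω).Reachable x (w.getVert i) := fun i => ⟨w.take i⟩
  have hmem : ∀ i, w.getVert i ∈ ω := fun i => mem_of_reachable hx (hreach i)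
  have hdist : ∀ i ≤ w.length, (siteGraph ω).dist x (w.getVert i) = i := by
    intro i hi
    have h1 := SimpleGraph.dist_le (w.take i)
    have h2 := SimpleGraph.dist_le (w.drop i)
    have h3 := (hreach i).dist_triangle_left y
    rw [SimpleGraph.Walk.take_length] at h1
    rw [SimpleGraph.Walk.drop_length] at h2
    omega
  refine ⟨w.length, w.getVert, w.getVert_zero, w.getVert_length, hmem,
    fun i hi => (w.adj_getVert_succ hi).1, ?_, ?_⟩
  · intro i j hi hj hij
    rw [← hdist i hi, hij, hdist j hj]
  · intro i j hi hj hij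
    have hadj : (siteGraph ω).Adj (w.getVert j) (w.getVert i) :=
      ⟨adjZ2_symm hij, hmem _, hmem _⟩
    have h3 := (hreach j).dist_triangle_left (w.getVert i)
    rw [hdist i hi, hdist j hj, SimpleGraph.dist_eq_one_iff_adj.2 hadj] at h3
    exact h3

/-! ### Nonessential enhancements preserve connections across a box -/

/-- The supremum norm of a site. -/
def supNorm (z : Site) : ℕ := max z.1.natAbs z.2.natAbs

/-- The `k`-th site of the outward ray that starts at the site `a` on the boundary of the box
`{z | supNorm z ≤ N}`. -/
def rayFrom (N : ℕ) (a : Site) (k : ℕ) : Site :=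
  if a.1 = N then (a.1 + k, a.2) else if a.1 = -N then (a.1 - k, a.2)
  else if a.2 = N then (a.1, a.2 + k) else (a.1, a.2 - k)

lemma supNorm_le_of_adj {x y : Site} (h : adjZ2 x y) : supNorm y ≤ supNorm x + 1 := by
  rw [adjZ2_iff] at h; unfold supNorm; omega

lemma finite_supNorm_le (N : ℕ) : {z : Site | supNorm z ≤ N}.Finite := by
  refine ((Set.finite_Icc (-(N : ℤ)) N).prod (Set.finite_Icc (-(N : ℤ)) N)).subset ?_
  intro z hz
  simp only [supNorm, mem_ofPred_eq, mem_prod, mem_Icc] at *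
  omega

lemma rayFrom_zero (N : ℕ) (a : Site) : rayFrom N a 0 = a := by
  unfold rayFrom; split_ifs <;> simp

lemma supNorm_rayFrom {N : ℕ} {a : Site} (ha : supNorm a = N) (k : ℕ) :
    supNorm (rayFrom N a k) = N + k := by
  unfold supNorm at *; unfold rayFrom; split_ifs <;> simp only <;> omega

lemma adj_rayFrom_succ (N : ℕ) (a : Site) (k : ℕ) :
    adjZ2 (rayFrom N a k) (rayFrom N a (k + 1)) := by
  rw [adjZ2_iff]; unfold rayFrom; split_ifs <;> push_cast <;> omega

lemma adj_rayFrom_iff {N : ℕ} {a : Site} (k l : ℕ) :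
    adjZ2 (rayFrom N a k) (rayFrom N a l) ↔ k = l + 1 ∨ l = k + 1 := by
  rw [adjZ2_iff]; unfold rayFrom; split_ifs <;> dsimp only <;> constructor <;> intro h <;> omega

lemma adj_rayFrom_box_iff {N : ℕ} {a z : Site} (ha : supNorm a = N) (hz : supNorm z ≤ N) {k : ℕ}
    (hk : 0 < k) : adjZ2 (rayFrom N a k) z ↔ k = 1 ∧ z = a := by
  rw [adjZ2_iff, Prod.ext_iff]; unfold supNorm at *; unfold rayFrom
  split_ifs <;> simp only <;> omega

lemma not_adj_rayFrom {N : ℕ} {a b : Site} (ha : supNorm a = N) (hb : supNorm b = N)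
    (hab : a ≠ b) (hadj : ¬ adjZ2 a b) (k l : ℕ) :
    ¬ adjZ2 (rayFrom N a k) (rayFrom N b l) := by
  obtain ⟨a₁, a₂⟩ := a
  obtain ⟨b₁, b₂⟩ := b
  have ha' : -(N : ℤ) ≤ a₁ ∧ a₁ ≤ N ∧ -(N : ℤ) ≤ a₂ ∧ a₂ ≤ N := by
    simp only [supNorm] at ha; omega
  have hb' : -(N : ℤ) ≤ b₁ ∧ b₁ ≤ N ∧ -(N : ℤ) ≤ b₂ ∧ b₂ ≤ N := by
    simp only [supNorm] at hb; omega
  have hab' : a₁ = b₁ → a₂ ≠ b₂ := fun h h' => hab (Prod.ext h h')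
  rw [adjZ2_iff] at *
  simp only at hadj
  have ha'' : a₁ = N ∨ a₁ = -N ∨ a₂ = N ∨ a₂ = -N := by simp only [supNorm] at ha; omega
  have hb'' : b₁ = N ∨ b₁ = -N ∨ b₂ = N ∨ b₂ = -N := by simp only [supNorm] at hb; omega
  clear ha hb hab
  unfold rayFrom
  split_ifs <;> simp only at * <;> rintro (⟨h, h' | h'⟩ | ⟨h, h' | h'⟩) <;> omega

lemma injective_of_adj_iff {γ : ℤ → Site}
    (h : ∀ i j : ℤ, adjZ2 (γ i) (γ j) ↔ (j = i + 1 ∨ i = j + 1)) : Function.Injective γ := by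
  intro i j hij
  have h1 := (h i (i + 1)).2 (Or.inl rfl)
  have h2 := (h i (i - 1)).2 (Or.inr (by ring))
  rw [hij, h] at h1 h2
  omega

lemma hasDISRPath_of_lt {ω : Config} {γ : ℤ → Site} (hγ : ∀ i, γ i ∈ ω)
    (h : ∀ i j : ℤ, i < j → (adjZ2 (γ i) (γ j) ↔ j = i + 1)) : HasDISRPath adjZ2 ω := by
  have h' : ∀ i j : ℤ, adjZ2 (γ i) (γ j) ↔ (j = i + 1 ∨ i = j + 1) := by
    intro i j
    rcases lt_trichotomy i j with hij | rfl | hij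
    · rw [h i j hij]; omega
    · simp [not_adjZ2_self]
    · have : adjZ2 (γ i) (γ j) ↔ adjZ2 (γ j) (γ i) := ⟨adjZ2_symm, adjZ2_symm⟩
      rw [this, h j i hij]; omega
  exact ⟨γ, injective_of_adj_iff h', hγ, h'⟩

/-- Two nonadjacent boundary sites of a box that are connected inside the box give a
doubly-infinite self-repelling path after attaching outward rays to them. -/
lemma hasDISRPath_of_reachable {N : ℕ} {a b : Site} (ha : supNorm a = N) (hb : supNorm b = N)
    (hab : a ≠ b) (hadj : ¬ adjZ2 a b) {S : Config} (haS : a ∈ S)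
    (hS : ∀ z ∈ S, supNorm z ≤ N) (h : (siteGraph S).Reachable a b) :
    HasDISRPath adjZ2 (S ∪ (range (rayFrom N a) ∪ range (rayFrom N b))) := by
  obtain ⟨n, f, f0, fn, fS, fadj, finj, fgeo⟩ := exists_geodesic haS h
  let γ : ℤ → Site := fun i =>
    if i < 0 then rayFrom N a (-i).toNat else if i ≤ n then f i.toNat
    else rayFrom N b (i - n).toNat
  have γneg : ∀ i : ℤ, i < 0 → γ i = rayFrom N a (-i).toNat := fun i hi => by simp [γ, hi]
  have γmid : ∀ i : ℤ, 0 ≤ i → i ≤ n → γ i = f i.toNat := fun i hi hi' => by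
    simp [γ, not_lt.2 hi, hi']
  have γpos : ∀ i : ℤ, n < i → γ i = rayFrom N b (i - n).toNat := fun i hi => by
    have : ¬ i < 0 := by omega
    simp [γ, this, not_le.2 hi]
  refine hasDISRPath_of_lt (γ := γ) ?_ ?_
  · intro i
    rcases lt_or_ge i 0 with hi | hi
    · rw [γneg i hi]; exact Or.inr (Or.inl ⟨_, rfl⟩)
    rcases le_or_gt i n with hi' | hi'
    · rw [γmid i hi hi']; exact Or.inl (fS _)
    · rw [γpos i hi']; exact Or.inr (Or.inr ⟨_, rfl⟩)
  · intro i j hij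
    rcases lt_or_ge i 0 with hi | hi
    · rw [γneg i hi]
      rcases lt_or_ge j 0 with hj | hj
      · rw [γneg j hj, adj_rayFrom_iff]; omega
      rcases le_or_gt j n with hj' | hj'
      · rw [γmid j hj hj', adj_rayFrom_box_iff ha (hS _ (fS _)) (by omega)]
        constructor
        · rintro ⟨h1, h2⟩
          have := finj j.toNat 0 (by omega) (by omega) (by rw [h2, f0])
          omega
        · intro h1
          obtain rfl : j = 0 := by omega
          exact ⟨by omega, f0⟩
      · rw [γpos j hj']
        have hn : n ≠ 0 := by rintro rfl; exact hab (f0.symm.trans fn)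
        exact iff_of_false (not_adj_rayFrom ha hb hab hadj _ _) (by omega)
    · rcases le_or_gt i n with hi' | hi'
      · rw [γmid i hi hi']
        rcases le_or_gt j n with hj' | hj'
        · rw [γmid j (by omega) hj']
          constructor
          · intro h1
            have := fgeo _ _ (by omega) (by omega) (adjZ2_symm h1)
            omega
          · rintro rfl
            have h1 := fadj i.toNat (by omega)
            rwa [show (i + 1).toNat = i.toNat + 1 by omega]
        · rw [γpos j hj']
          have : adjZ2 (f i.toNat) (rayFrom N b (j - n).toNat) ↔
              adjZ2 (rayFrom N b (j - n).toNat) (f i.toNat) := ⟨adjZ2_symm, adjZ2_symm⟩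
          rw [this, adj_rayFrom_box_iff hb (hS _ (fS _)) (by omega)]
          constructor
          · rintro ⟨h1, h2⟩
            have := finj i.toNat n (by omega) le_rfl (by rw [h2, fn])
            omega
          · rintro h1
            obtain rfl : i = n := by omega
            exact ⟨by omega, by simpa using fn⟩
      · rw [γpos i hi', γpos j (by omega), adj_rayFrom_iff]
        omega

lemma exists_supNorm_eq {f : ℕ → Site} (hf : Function.Injective f)
    (hadj : ∀ i, adjZ2 (f i) (f (i + 1))) {R : ℕ} (hR : supNorm (f 0) < R) :
    ∃ i, 0 < i ∧ supNorm (f i) = R := by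
  have hex : ∃ i, R ≤ supNorm (f i) := by
    by_contra! hcon
    exact Set.infinite_range_of_injective hf
      ((finite_supNorm_le R).subset (by rintro _ ⟨i, rfl⟩; exact (hcon i).le))
  classical
  refine ⟨Nat.find hex, ?_, le_antisymm ?_ (Nat.find_spec hex)⟩
  · rw [Nat.pos_iff_ne_zero]
    intro h0
    have := Nat.find_spec hex
    rw [h0] at this
    omega
  · obtain ⟨m, hm⟩ : ∃ m, Nat.find hex = m + 1 := by
      refine Nat.exists_eq_succ_of_ne_zero fun h0 => ?_
      have := Nat.find_spec hex
      rw [h0] at this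
      omega
    have h1 := Nat.find_min hex (m := m) (by omega)
    have h2 := supNorm_le_of_adj (hadj m)
    rw [hm]
    omega

/-- A doubly-infinite path in a subset of a box with two outward rays attached passes through
both rays. -/
lemma reachable_of_hasDISRPath {N : ℕ} {a b : Site} (ha : supNorm a = N) (hb : supNorm b = N)
    (hab : a ≠ b) (hadj : ¬ adjZ2 a b) {S : Config} (hS : ∀ z ∈ S, supNorm z ≤ N)
    (haS : a ∈ S) (hbS : b ∈ S)
    (h : HasDISRPath adjZ2 (S ∪ (range (rayFrom N a) ∪ range (rayFrom N b)))) :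
    (siteGraph S).Reachable a b := by
  set T : Config := S ∪ (range (rayFrom N a) ∪ range (rayFrom N b)) with hT
  obtain ⟨γ, γinj, γT, γadj⟩ := h
  have key : (siteGraph T).Reachable a b := by
    have hray : ∀ c, range (rayFrom N c) ⊆ T → ∀ k, (siteGraph T).Reachable c (rayFrom N c k) := by
      intro c hc k
      induction k with
      | zero => rw [rayFrom_zero]
      | succ k ih =>
        exact ih.trans (SimpleGraph.Adj.reachable
          ⟨adj_rayFrom_succ N c k, hc ⟨_, rfl⟩, hc ⟨_, rfl⟩⟩)
    have hpath : ∀ (i : ℤ) (k : ℕ), (siteGraph T).Reachable (γ i) (γ (i + k)) := by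
      intro i k
      induction k with
      | zero => simp
      | succ k ih =>
        refine ih.trans (SimpleGraph.Adj.reachable ⟨?_, γT _, γT _⟩)
        rw [γadj]; push_cast; left; ring
    have hconn : ∀ i j : ℤ, (siteGraph T).Reachable (γ i) (γ j) := by
      intro i j
      rcases le_total i j with hij | hij
      · have := hpath i (j - i).toNat
        rwa [show i + ((j - i).toNat : ℤ) = j by omega] at this
      · have := hpath j (i - j).toNat
        rw [show j + ((i - j).toNat : ℤ) = i by omega] at this
        exact this.symm
    set R := max (supNorm (γ 0)) N + 1 with hR
    have hR0 : supNorm (γ 0) < R := by omega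
    obtain ⟨i, hi, hiR⟩ := exists_supNorm_eq (f := fun n : ℕ => γ n) (R := R)
      (fun m n hmn => by exact_mod_cast γinj hmn)
      (fun n => by rw [γadj]; push_cast; left; ring) (by simpa using hR0)
    obtain ⟨j, hj, hjR⟩ := exists_supNorm_eq (f := fun n : ℕ => γ (-n)) (R := R)
      (fun m n hmn => by have := γinj hmn; omega)
      (fun n => by rw [γadj]; push_cast; right; ring)
      (by simpa using hR0)
    have hne : γ i ≠ γ (-j) := fun h => by have := γinj h; omega
    have hlevel : ∀ z ∈ T, supNorm z = R → z = rayFrom N a (R - N) ∨ z = rayFrom N b (R - N) := by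
      rintro z (hz | ⟨k, rfl⟩ | ⟨k, rfl⟩) hzR
      · have := hS z hz; omega
      · rw [supNorm_rayFrom ha] at hzR
        left; congr 1; omega
      · rw [supNorm_rayFrom hb] at hzR
        right; congr 1; omega
    have hra := hray a (fun z hz => Or.inr (Or.inl hz)) (R - N)
    have hrb := hray b (fun z hz => Or.inr (Or.inr hz)) (R - N)
    have hij := hconn i (-j)
    rcases hlevel _ (γT i) hiR with h1 | h1 <;> rcases hlevel _ (γT (-j)) hjR with h2 | h2
    · exact absurd (h1.trans h2.symm) hne
    · rw [h1, h2] at hij; exact hra.trans (hij.trans hrb.symm)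
    · rw [h1, h2] at hij; exact hra.trans (hij.symm.trans hrb.symm)
    · exact absurd (h1.trans h2.symm) hne
  classical
  let r : Site → Site := fun z =>
    if supNorm z ≤ N then z else if z ∈ range (rayFrom N a) then a else b
  have hbox : ∀ z ∈ T, supNorm z ≤ N → z ∈ S := by
    rintro z (hz | ⟨k, rfl⟩ | ⟨k, rfl⟩) hzN
    · exact hz
    · rw [supNorm_rayFrom ha] at hzN
      obtain rfl : k = 0 := by omega
      rwa [rayFrom_zero]
    · rw [supNorm_rayFrom hb] at hzN
      obtain rfl : k = 0 := by omega
      rwa [rayFrom_zero]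
  have hr : ∀ z, supNorm z ≤ N → r z = z := fun z hz => by simp [r, hz]
  have hra : ∀ k, r (rayFrom N a k) = a := by
    intro k
    rcases Nat.eq_zero_or_pos k with rfl | hk
    · rw [rayFrom_zero]; exact hr a ha.le
    · have : ¬ supNorm (rayFrom N a k) ≤ N := by rw [supNorm_rayFrom ha]; omega
      simp [r, this]
  have hrb : ∀ k, r (rayFrom N b k) = b := by
    intro k
    rcases Nat.eq_zero_or_pos k with rfl | hk
    · rw [rayFrom_zero]; exact hr b hb.le
    · have h1 : ¬ supNorm (rayFrom N b k) ≤ N := by rw [supNorm_rayFrom hb]; omega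
      have h2 : rayFrom N b k ∉ range (rayFrom N a) := by
        rintro ⟨l, hl⟩
        have := adj_rayFrom_succ N b k
        rw [← hl] at this
        exact not_adj_rayFrom ha hb hab hadj _ _ this
      simp only [r, h1, h2, if_false]
  have hstep : ∀ x y, x ∈ T → y ∈ T → adjZ2 x y → (siteGraph S).Reachable (r x) (r y) := by
    have hcross : ∀ c, supNorm c = N → (∀ k, r (rayFrom N c k) = c) → ∀ k z, z ∈ T →
        supNorm z ≤ N → adjZ2 (rayFrom N c k) z → c ∈ S →
        (siteGraph S).Reachable (r (rayFrom N c k)) (r z) := by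
      intro c hc hrc k z hzT hz hcz hcS
      rw [hrc, hr z hz]
      rcases Nat.eq_zero_or_pos k with rfl | hk
      · rw [rayFrom_zero] at hcz
        exact SimpleGraph.Adj.reachable ⟨hcz, hcS, hbox z hzT hz⟩
      · rw [((adj_rayFrom_box_iff hc hz hk).1 hcz).2]
    rintro x y hx hy hxy
    rcases hx with hx' | ⟨k, rfl⟩ | ⟨k, rfl⟩ <;> rcases hy with hy' | ⟨l, rfl⟩ | ⟨l, rfl⟩
    · rw [hr x (hS x hx'), hr y (hS y hy')]
      exact SimpleGraph.Adj.reachable ⟨hxy, hx', hy'⟩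
    · exact (hcross a ha hra l x (Or.inl hx') (hS x hx') (adjZ2_symm hxy) haS).symm
    · exact (hcross b hb hrb l x (Or.inl hx') (hS x hx') (adjZ2_symm hxy) hbS).symm
    · exact hcross a ha hra k y (Or.inl hy') (hS y hy') hxy haS
    · rw [hra, hra]
    · exact absurd hxy (not_adj_rayFrom ha hb hab hadj _ _)
    · exact hcross b hb hrb k y (Or.inl hy') (hS y hy') hxy hbS
    · exact absurd (adjZ2_symm hxy) (not_adj_rayFrom ha hb hab hadj _ _)
    · rw [hrb, hrb]
  have hall : ∀ y, (siteGraph T).Reachable a y → (siteGraph S).Reachable (r a) (r y) := by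
    intro y hy
    rw [SimpleGraph.reachable_iff_reflTransGen] at hy
    induction hy with
    | refl => exact SimpleGraph.Reachable.refl _
    | tail _ hbc ih => exact ih.trans (hstep _ _ hbc.2.1 hbc.2.2 hbc.1)
  have := hall b key
  rwa [hr a ha.le, hr b hb.le] at this

/-- The sites of the box of radius `N` centred at the origin. -/
def centredBox (N : ℕ) : Set Site := {z | supNorm z ≤ N}

lemma supNorm_lt_of_mem_siteBall {R₀ : ℝ} {N : ℕ} (hN : R₀ < N) {z : Site}
    (hz : z ∈ siteBall R₀) : supNorm z < N := by
  have hz' : siteNorm z ≤ R₀ := hz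
  have h1 : |(z.1 : ℝ)| ≤ siteNorm z := Real.abs_le_sqrt (by nlinarith [sq_nonneg (z.2 : ℝ)])
  have h2 : |(z.2 : ℝ)| ≤ siteNorm z := Real.abs_le_sqrt (by nlinarith [sq_nonneg (z.1 : ℝ)])
  have h3 : ((z.1.natAbs : ℕ) : ℝ) < N := by
    rw [Nat.cast_natAbs, Int.cast_abs]; linarith
  have h4 : ((z.2.natAbs : ℕ) : ℝ) < N := by
    rw [Nat.cast_natAbs, Int.cast_abs]; linarith
  exact max_lt (by exact_mod_cast h3) (by exact_mod_cast h4)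

lemma supNorm_sub_le (x y : Site) : supNorm (x - y) ≤ supNorm x + supNorm y := by
  simp only [supNorm, Prod.fst_sub, Prod.snd_sub]
  omega

lemma supNorm_sub_of_adj {x y : Site} (h : adjZ2 x y) : supNorm (y - x) ≤ 1 := by
  rw [adjZ2_iff] at h
  simp only [supNorm, Prod.fst_sub, Prod.snd_sub]
  omega

section Deterministic

variable {R₀ : ℝ} {φ : Config → Config} {N : ℕ}

/-- A nonessential enhancement at the origin creates no new connection inside a box between
boundary sites of the box. -/
lemma reachable_box_of_enhance (hφ : IsEnhancement R₀ φ) (hness : ¬ Essential adjZ2 φ)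
    (hN : R₀ < N) {ω : Config} {a b : Site} (ha : supNorm a = N) (hb : supNorm b = N)
    (haω : a ∈ ω) (hbω : b ∈ ω)
    (h : (siteGraph ((ω ∪ φ ω) ∩ centredBox N)).Reachable a b) :
    (siteGraph (ω ∩ centredBox N)).Reachable a b := by
  rcases eq_or_ne a b with rfl | hab
  · exact SimpleGraph.Reachable.refl _
  by_cases hadj : adjZ2 a b
  · exact SimpleGraph.Adj.reachable ⟨hadj, ⟨haω, ha.le⟩, ⟨hbω, hb.le⟩⟩
  refine reachable_of_hasDISRPath ha hb hab hadj (fun z hz => hz.2) ⟨haω, ha.le⟩ ⟨hbω, hb.le⟩ ?_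
  by_contra hcon
  refine hness ⟨_, hcon, ?_⟩
  have hray : ∀ c, supNorm c = N → ∀ z ∈ range (rayFrom N c), z ∉ siteBall R₀ := by
    rintro c hc _ ⟨k, rfl⟩ hz
    have := supNorm_lt_of_mem_siteBall hN hz
    rw [supNorm_rayFrom hc] at this
    omega
  have hφeq : φ (ω ∩ centredBox N ∪ (range (rayFrom N a) ∪ range (rayFrom N b))) = φ ω := by
    refine hφ.2.2 _ _ (Set.ext fun z => ⟨?_, ?_⟩)
    · rintro ⟨hz | hz | hz, hz'⟩
      · exact ⟨hz.1, hz'⟩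
      · exact absurd hz' (hray a ha z hz)
      · exact absurd hz' (hray b hb z hz)
    · rintro ⟨hz, hz'⟩
      exact ⟨Or.inl ⟨hz, (supNorm_lt_of_mem_siteBall hN hz').le⟩, hz'⟩
  have hset : ω ∩ centredBox N ∪ (range (rayFrom N a) ∪ range (rayFrom N b)) ∪ φ ω =
      (ω ∪ φ ω) ∩ centredBox N ∪ (range (rayFrom N a) ∪ range (rayFrom N b)) := by
    have hsub : φ ω ⊆ centredBox N := fun z hz =>
      (supNorm_lt_of_mem_siteBall hN (hφ.2.1 ω hz)).le
    ext z
    have := @hsub z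
    simp only [mem_union, mem_inter_iff]
    tauto
  rw [hφeq, hset]
  exact hasDISRPath_of_reachable ha hb hab hadj ⟨Or.inl haω, ha.le⟩ (fun z hz => hz.2) h

lemma reachable_of_enhance_zero (hφ : IsEnhancement R₀ φ) (hness : ¬ Essential adjZ2 φ)
    (hN : R₀ < N) {ω : Config} {u v : Site} (huω : u ∈ ω) (hu : N ≤ supNorm u)
    (hv : N ≤ supNorm v) (h : (siteGraph (ω ∪ φ ω)).Reachable u v) :
    (siteGraph ω).Reachable u v := by
  have hout : ∀ z ∈ ω ∪ φ ω, N ≤ supNorm z → z ∈ ω := by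
    rintro z (hz | hz) hzN
    · exact hz
    · exact absurd (supNorm_lt_of_mem_siteBall hN (hφ.2.1 ω hz)) (not_lt.2 hzN)
  suffices H : ∀ w, (siteGraph (ω ∪ φ ω)).Reachable u w →
      (N ≤ supNorm w → (siteGraph ω).Reachable u w) ∧
      (supNorm w ≤ N → ∃ a ∈ ω, supNorm a = N ∧ (siteGraph ω).Reachable u a ∧
        (siteGraph ((ω ∪ φ ω) ∩ centredBox N)).Reachable a w) from (H v h).1 hv
  intro w hw
  rw [SimpleGraph.reachable_iff_reflTransGen] at hw
  induction hw with
  | refl =>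
    exact ⟨fun _ => SimpleGraph.Reachable.refl _, fun h' => ⟨u, huω, le_antisymm h' hu,
      SimpleGraph.Reachable.refl _, SimpleGraph.Reachable.refl _⟩⟩
  | @tail w w' _ hww' ih =>
    obtain ⟨hadj, hw, hw'⟩ := hww'
    have hle := supNorm_le_of_adj hadj
    have hle' := supNorm_le_of_adj (adjZ2_symm hadj)
    have hreach : N ≤ supNorm w' → (siteGraph ω).Reachable u w' := by
      intro hN'
      by_cases hwN : supNorm w ≤ N
      · by_cases hwN' : supNorm w' = N
        · obtain ⟨a, haω, haN, hua, haw⟩ := ih.2 hwN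
          have haw' := haw.trans (SimpleGraph.Adj.reachable
            (⟨hadj, ⟨hw, hwN⟩, ⟨hw', hwN'.le⟩⟩ :
              (siteGraph ((ω ∪ φ ω) ∩ centredBox N)).Adj w w'))
          exact hua.trans ((reachable_box_of_enhance hφ hness hN haN hwN' haω
            (hout _ hw' hN') haw').mono (siteGraph_mono inter_subset_left))
        · exact (ih.1 (by omega)).trans (SimpleGraph.Adj.reachable
            ⟨hadj, hout _ hw (by omega), hout _ hw' hN'⟩)
      · exact (ih.1 (by omega)).trans (SimpleGraph.Adj.reachable
            ⟨hadj, hout _ hw (by omega), hout _ hw' hN'⟩)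
    refine ⟨hreach, fun hN' => ?_⟩
    rcases hN'.eq_or_lt with heq | hlt
    · exact ⟨w', hout _ hw' heq.ge, heq, hreach heq.ge, SimpleGraph.Reachable.refl _⟩
    · obtain ⟨a, haω, haN, hua, haw⟩ := ih.2 (by omega)
      exact ⟨a, haω, haN, hua, haw.trans (SimpleGraph.Adj.reachable
        ⟨hadj, ⟨hw, by change supNorm w ≤ N; omega⟩, ⟨hw', hN'⟩⟩)⟩

lemma reachable_shift_iff (x : Site) (ω : Config) (u v : Site) :
    (siteGraph (shiftConfig x ω)).Reachable (u - x) (v - x) ↔ (siteGraph ω).Reachable u v := by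
  have hadj : ∀ a b c : Site, adjZ2 (a + c) (b + c) ↔ adjZ2 a b := by
    intro a b c
    simp [adjZ2]
  let f : siteGraph (shiftConfig x ω) →g siteGraph ω :=
    ⟨fun z => z + x, fun {a b} h => ⟨(hadj a b x).2 h.1, h.2.1, h.2.2⟩⟩
  let g : siteGraph ω →g siteGraph (shiftConfig x ω) :=
    ⟨fun z => z - x, fun {a b} h => ⟨by simpa only [sub_eq_add_neg, hadj] using h.1,
      by simpa [shiftConfig] using h.2.1, by simpa [shiftConfig] using h.2.2⟩⟩
  constructor
  · intro h
    have h' : (siteGraph ω).Reachable (u - x + x) (v - x + x) := h.map f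
    rwa [sub_add_cancel, sub_add_cancel] at h'
  · intro h
    exact h.map g

/-- A single nonessential enhancement at `x` creates no new connection between sites that are
far from `x`. -/
lemma reachable_of_enhAt (hφ : IsEnhancement R₀ φ) (hness : ¬ Essential adjZ2 φ)
    (hN : R₀ < N) {ω : Config} {x u v : Site} (huω : u ∈ ω) (hu : N ≤ supNorm (u - x))
    (hv : N ≤ supNorm (v - x)) (h : (siteGraph (ω ∪ enhAt φ x ω)).Reachable u v) :
    (siteGraph ω).Reachable u v := by
  have hset : shiftConfig x (ω ∪ enhAt φ x ω) = shiftConfig x ω ∪ φ (shiftConfig x ω) := by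
    ext z
    simp [shiftConfig, enhAt]
  rw [← reachable_shift_iff x] at h ⊢
  rw [hset] at h
  exact reachable_of_enhance_zero hφ hness hN (by simpa [shiftConfig] using huω) hu hv h

lemma enhAt_mono (hmono : Monotonic φ) {ω ω' : Config} (h : ω ⊆ ω') (x : Site) :
    enhAt φ x ω ⊆ enhAt φ x ω' :=
  image_mono (hmono _ _ fun _ hz => h hz)

/-- Successive enhancement at the sites of a list. -/
def enhanceList (φ : Config → Config) (ω : Config) : List Site → Config
  | [] => ω
  | x :: l => enhanceList φ ω l ∪ enhAt φ x (enhanceList φ ω l)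

lemma subset_enhanceList (ω : Config) (l : List Site) : ω ⊆ enhanceList φ ω l := by
  induction l with
  | nil => exact subset_rfl
  | cons x l ih => exact ih.trans subset_union_left

lemma reachable_of_enhanceList (hφ : IsEnhancement R₀ φ) (hness : ¬ Essential adjZ2 φ)
    (hN : R₀ < N) {ω : Config} {u v : Site} (huω : u ∈ ω) {l : List Site}
    (hl : ∀ x ∈ l, N ≤ supNorm (u - x) ∧ N ≤ supNorm (v - x))
    (h : (siteGraph (enhanceList φ ω l)).Reachable u v) : (siteGraph ω).Reachable u v := by
  induction l with
  | nil => exact h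
  | cons x l ih =>
    refine ih (fun y hy => hl y (List.mem_cons_of_mem _ hy)) ?_
    have hx := hl x List.mem_cons_self
    exact reachable_of_enhAt hφ hness hN (subset_enhanceList ω l huω) hx.1 hx.2 h

/-- Every connection in a configuration enhanced at the sites of `X` only uses finitely many
enhancements. -/
lemma exists_enhanceList (hmono : Monotonic φ) {ω : Config} {X : Set Site} {u v : Site}
    (huω : u ∈ ω)
    (h : (siteGraph (ω ∪ {y | ∃ x ∈ X, y ∈ enhAt φ x ω})).Reachable u v) :
    ∃ l : List Site, (∀ x ∈ l, x ∈ X) ∧ (siteGraph (enhanceList φ ω l)).Reachable u v := by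
  rw [SimpleGraph.reachable_iff_reflTransGen] at h
  induction h with
  | refl => exact ⟨[], by simp, SimpleGraph.Reachable.refl _⟩
  | @tail w w' _ hww' ih =>
    obtain ⟨l, hl, hr⟩ := ih
    have hw : w ∈ enhanceList φ ω l := mem_of_reachable (subset_enhanceList ω l huω) hr
    rcases hww'.2.2 with hw' | ⟨x, hx, hw'⟩
    · exact ⟨l, hl, hr.trans (SimpleGraph.Adj.reachable
        ⟨hww'.1, hw, subset_enhanceList ω l hw'⟩)⟩
    · refine ⟨x :: l, by simpa [hx] using hl, (hr.mono (siteGraph_mono subset_union_left)).trans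
        (SimpleGraph.Adj.reachable ⟨hww'.1, Or.inl hw, Or.inr ?_⟩)⟩
      exact enhAt_mono hmono (subset_enhanceList ω l) x hw'

/-- The box of radius `K` centred at `u`. -/
noncomputable def boxAt (K : ℕ) (u : Site) : Finset Site :=
  Finset.Icc (u.1 - K) (u.1 + K) ×ˢ Finset.Icc (u.2 - K) (u.2 + K)

lemma mem_boxAt {K : ℕ} {u z : Site} : z ∈ boxAt K u ↔ supNorm (z - u) ≤ K := by
  simp only [boxAt, Finset.mem_product, Finset.mem_Icc, supNorm, Prod.fst_sub, Prod.snd_sub]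
  omega

lemma card_boxAt (K : ℕ) (u : Site) : (boxAt K u).card = (2 * K + 1) ^ 2 := by
  have h : ∀ a : ℤ, (a + K + 1 - (a - K)).toNat = 2 * K + 1 := fun a => by omega
  simp only [boxAt, Finset.card_product, Int.card_Icc, h]
  ring

/-- If `u` and `v` are connected in the enhanced configuration, then they are connected in the
original configuration after opening all sites of boxes around `u` and `v`. -/
theorem connectedIn_of_enhanced (hφ : IsEnhancement R₀ φ) (hmono : Monotonic φ)
    (hness : ¬ Essential adjZ2 φ) (hN : R₀ < N) {ω : Config} {α : Site → Bool} {u v : Site}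
    (h : ConnectedIn adjZ2 (enhanced φ ω α) u v) :
    ConnectedIn adjZ2 (ω ∪ (↑(boxAt (2 * N) u) ∪ ↑(boxAt (2 * N) v))) u v := by
  rw [connectedIn_iff] at *
  set ω' : Config := ω ∪ (↑(boxAt (2 * N) u) ∪ ↑(boxAt (2 * N) v)) with hω'
  have huω : u ∈ ω' := Or.inr (Or.inl (by
    rw [Finset.mem_coe, mem_boxAt, sub_self]; simp [supNorm]))
  refine ⟨huω, ?_⟩
  let X : Set Site := {x | N ≤ supNorm (u - x) ∧ N ≤ supNorm (v - x)}
  have hsub : enhanced φ ω α ⊆ ω' ∪ {y | ∃ x ∈ X, y ∈ enhAt φ x ω'} := by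
    rintro y (hy | ⟨x, -, hy⟩)
    · exact Or.inl (Or.inl hy)
    · by_cases hx : x ∈ X
      · exact Or.inr ⟨x, hx, enhAt_mono hmono subset_union_left x hy⟩
      · left; right
        obtain ⟨z, hz, rfl⟩ := hy
        have hzN := supNorm_lt_of_mem_siteBall hN (hφ.2.1 _ hz)
        have hx' : supNorm (u - x) < N ∨ supNorm (v - x) < N := by
          by_contra! hcon
          exact hx hcon
        have hclose : ∀ w : Site, supNorm (w - x) < N → z + x ∈ boxAt (2 * N) w := by
          intro w hw
          have h1 := supNorm_sub_le z (w - x)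
          rw [mem_boxAt, show z + x - w = z - (w - x) by abel]
          omega
        exact hx'.imp (fun h => hclose u h) (fun h => hclose v h)
  obtain ⟨l, hl, hr⟩ := exists_enhanceList hmono huω (h.2.mono (siteGraph_mono hsub))
  exact reachable_of_enhanceList hφ hness hN huω hl hr

/-- If the origin lies in an infinite cluster of the enhanced configuration, then it lies in an
infinite cluster of the original configuration after opening all sites of a box around it. -/
theorem inInfiniteCluster_of_enhanced (hφ : IsEnhancement R₀ φ) (hmono : Monotonic φ)
    (hness : ¬ Essential adjZ2 φ) (hN : R₀ < N) {ω : Config} {α : Site → Bool} {u : Site}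
    (h : InInfiniteCluster adjZ2 (enhanced φ ω α) u) :
    InInfiniteCluster adjZ2 (ω ∪ ↑(boxAt (2 * N) u)) u := by
  by_contra hfin
  rw [InInfiniteCluster, Set.not_infinite] at hfin
  set T := {z | ConnectedIn adjZ2 (ω ∪ ↑(boxAt (2 * N) u)) u z} with hT
  refine h (((hfin.biUnion fun z _ => (boxAt (2 * N + 1) z).finite_toSet)).subset ?_)
  intro y hy
  have hy' := (connectedIn_iff.1 (connectedIn_of_enhanced hφ hmono hness hN hy)).2
  have hself : ∀ (K : ℕ) (z : Site), z ∈ boxAt K z := fun K z => by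
    rw [mem_boxAt, sub_self]; simp [supNorm]
  suffices H : ∀ w, (siteGraph (ω ∪ (↑(boxAt (2 * N) u) ∪ ↑(boxAt (2 * N) y)))).Reachable u w →
      w ∈ T ∨ ∃ z ∈ T, y ∈ boxAt (2 * N + 1) z by
    rcases H y hy' with hyT | ⟨z, hz, hyz⟩
    · exact mem_biUnion hyT (hself _ _)
    · exact mem_biUnion hz hyz
  intro w hw
  rw [SimpleGraph.reachable_iff_reflTransGen] at hw
  induction hw with
  | refl =>
    exact Or.inl (connectedIn_iff.2 ⟨Or.inr (hself _ _), SimpleGraph.Reachable.refl _⟩)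
  | @tail w w' _ hww' ih =>
    rcases ih with hwT | hz
    · by_cases hw' : w' ∈ ω ∪ ↑(boxAt (2 * N) u)
      · obtain ⟨h1, h2⟩ := connectedIn_iff.1 hwT
        exact Or.inl (connectedIn_iff.2 ⟨h1, h2.trans (SimpleGraph.Adj.reachable
          ⟨hww'.1, mem_of_reachable h1 h2, hw'⟩)⟩)
      · right
        refine ⟨w, hwT, ?_⟩
        have hbox : w' ∈ boxAt (2 * N) y := by
          rcases hww'.2.2 with h1 | h1 | h1
          · exact absurd (Or.inl h1) hw'
          · exact absurd (Or.inr h1) hw'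
          · exact h1
        have hadj := hww'.1
        rw [mem_boxAt] at hbox ⊢
        have h1 := supNorm_sub_le (w' - w) (w' - y)
        have h2 := supNorm_sub_of_adj hadj
        rw [sub_sub_sub_cancel_left] at h1
        omega
    · exact Or.inr hz

end Deterministic

/-! ### Opening finitely many sites -/

/-- The event that all sites of `F` are open. -/
def allOpen (F : Finset Site) : Set (Site → Bool) := {η | ∀ z ∈ F, η z = true}

lemma measure_allOpen {p : ℝ} {μ : Measure (Site → Bool)} (hμ : IsBernoulli p μ)
    (F : Finset Site) : μ (allOpen F) = ENNReal.ofReal p ^ F.card := by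
  have h := hμ.2 F (fun _ => true)
  simp only [if_true, Finset.prod_const] at h
  exact h

lemma measure_allClosed {p : ℝ} {μ : Measure (Site → Bool)} (hμ : IsBernoulli p μ)
    (F : Finset Site) :
    μ {η | ∀ z ∈ F, η z = false} = ENNReal.ofReal (1 - p) ^ F.card := by
  have h := hμ.2 F (fun _ => false)
  simp only [Bool.false_eq_true, if_false, Finset.prod_const] at h
  exact h

lemma measurableSet_allOpen (F : Finset Site) : MeasurableSet (allOpen F) := by
  have : allOpen F = ⋂ z ∈ F, {η | η z = true} := by ext; simp [allOpen]
  rw [this]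
  exact Finset.measurableSet_biInter _ fun z _ =>
    measurableSet_eq_fun (measurable_pi_apply z) measurable_const

lemma allOpen_inter (F F' : Finset Site) : allOpen F ∩ allOpen F' = allOpen (F ∪ F') := by
  ext η
  simp only [allOpen, mem_inter_iff, mem_ofPred_eq, Finset.mem_union]
  exact ⟨fun h z hz => hz.elim (h.1 z) (h.2 z),
    fun h => ⟨fun z hz => h z (Or.inl hz), fun z hz => h z (Or.inr hz)⟩⟩

lemma generateFrom_allOpen :
    (MeasurableSpace.pi : MeasurableSpace (Site → Bool)) =
      MeasurableSpace.generateFrom (range allOpen) := by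
  apply le_antisymm
  · refine iSup_le fun z => ?_
    rw [← measurable_iff_comap_le]
    refine @measurable_to_bool _ (MeasurableSpace.generateFrom (range allOpen)) _ ?_
    refine MeasurableSpace.measurableSet_generateFrom ⟨{z}, ?_⟩
    ext η
    simp [allOpen]
  · refine MeasurableSpace.generateFrom_le ?_
    rintro _ ⟨F, rfl⟩
    exact measurableSet_allOpen F

/-- Open all sites of `F`. -/
def openOn (F : Finset Site) (η : Site → Bool) : Site → Bool :=
  fun z => if z ∈ F then true else η z

lemma toConfig_openOn (F : Finset Site) (η : Site → Bool) :
    toConfig (openOn F η) = toConfig η ∪ ↑F := by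
  ext z
  by_cases hz : z ∈ F <;> simp [toConfig, openOn, hz]

lemma measurable_openOn (F : Finset Site) : Measurable (openOn F) := by
  refine measurable_pi_lambda _ fun z => ?_
  by_cases hz : z ∈ F
  · simp only [openOn, hz, if_true]; exact measurable_const
  · simp only [openOn, hz, if_false]; exact measurable_pi_apply z

/-- Finite-energy property: opening the sites of `F` increases the probability of an event by a
factor of at most `p ^ (-|F|)`. -/
lemma measure_openOn_le {p : ℝ} {μ : Measure (Site → Bool)} (hμ : IsBernoulli p μ)
    (F : Finset Site) {A : Set (Site → Bool)} (hA : MeasurableSet A) :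
    ENNReal.ofReal p ^ F.card * μ (openOn F ⁻¹' A) ≤ μ A := by
  have := hμ.1
  have key : (ENNReal.ofReal p ^ F.card) • μ.map (openOn F) = μ.restrict (allOpen F) := by
    have hpre : ∀ G, openOn F ⁻¹' allOpen G = allOpen (G \ F) := by
      intro G
      ext η
      simp only [allOpen, openOn, mem_preimage, mem_ofPred_eq, Finset.mem_sdiff]
      refine forall_congr' fun z => ?_
      by_cases hz : z ∈ F <;> simp [hz]
    have hfin : IsFiniteMeasure ((ENNReal.ofReal p ^ F.card) • μ.map (openOn F)) :=
      Measure.smul_finite _ (ENNReal.pow_ne_top ENNReal.ofReal_ne_top)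
    refine ext_of_generate_finite _ generateFrom_allOpen ?_ ?_ ?_
    · rintro _ ⟨G, rfl⟩ _ ⟨G', rfl⟩ -
      exact ⟨G ∪ G', (allOpen_inter G G').symm⟩
    · rintro _ ⟨G, rfl⟩
      rw [Measure.smul_apply, Measure.map_apply (measurable_openOn F) (measurableSet_allOpen G),
        Measure.restrict_apply (measurableSet_allOpen G), hpre, allOpen_inter,
        measure_allOpen hμ, measure_allOpen hμ, smul_eq_mul, ← pow_add]
      congr 1
      rw [← Finset.card_sdiff_add_card, add_comm]
    · rw [Measure.smul_apply, Measure.map_apply (measurable_openOn F) MeasurableSet.univ,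
        preimage_univ, measure_univ, Measure.restrict_apply_univ, measure_allOpen hμ,
        smul_eq_mul, mul_one]
  calc ENNReal.ofReal p ^ F.card * μ (openOn F ⁻¹' A)
      = ((ENNReal.ofReal p ^ F.card) • μ.map (openOn F)) A := by
        rw [Measure.smul_apply, Measure.map_apply (measurable_openOn F) hA, smul_eq_mul]
    _ ≤ μ A := by rw [key]; exact Measure.restrict_apply_le _ _

lemma measurableSet_connectedIn (x y : Site) :
    MeasurableSet {η : Site → Bool | ConnectedIn adjZ2 (toConfig η) x y} := by
  have : {η : Site → Bool | ConnectedIn adjZ2 (toConfig η) x y} =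
      ⋃ l ∈ {l : List Site | IsPathOn adjZ2 l ∧ l.head? = some x ∧ l.getLast? = some y},
        allOpen l.toFinset := by
    ext η
    simp only [ConnectedIn, mem_ofPred_eq, mem_iUnion, allOpen, List.mem_toFinset, toConfig,
      exists_prop]
    exact exists_congr fun l => by tauto
  rw [this]
  exact MeasurableSet.biUnion (to_countable _) fun l _ => measurableSet_allOpen _

lemma measurableSet_inInfiniteCluster (x : Site) :
    MeasurableSet {η : Site → Bool | InInfiniteCluster adjZ2 (toConfig η) x} := by
  have : {η : Site → Bool | InInfiniteCluster adjZ2 (toConfig η) x} =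
      ⋂ F : Finset Site, ⋃ y ∈ {y | y ∉ F},
        {η : Site → Bool | ConnectedIn adjZ2 (toConfig η) x y} := by
    ext η
    simp only [InInfiniteCluster, mem_ofPred_eq, mem_iInter, mem_iUnion, exists_prop]
    constructor
    · intro h F
      obtain ⟨y, hy, hyF⟩ := h.exists_notMem_finset F
      exact ⟨y, hyF, hy⟩
    · intro h hfin
      obtain ⟨y, hyF, hy⟩ := h hfin.toFinset
      exact hyF (by simpa using hy)
  rw [this]
  exact MeasurableSet.iInter fun F => MeasurableSet.biUnion (to_countable _) fun y _ =>
    measurableSet_connectedIn x y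

/-! ### Comparison of the enhanced process with the independent process -/

section Comparison

variable {R₀ : ℝ} {φ : Config → Config} {N : ℕ} {p : ℝ} {μ ν : Measure (Site → Bool)}

lemma subset_enhanced (ω : Config) (α : Site → Bool) : ω ⊆ enhanced φ ω α :=
  subset_union_left

lemma measure_le_prod_of_imp [SFinite μ] [IsProbabilityMeasure ν]
    {A : Set (Site → Bool)} {B : Set ((Site → Bool) × (Site → Bool))}
    (h : ∀ η α, η ∈ A → (η, α) ∈ B) : μ A ≤ (μ.prod ν) B := by
  calc μ A = (μ.prod ν) (A ×ˢ univ) := by rw [Measure.prod_prod, measure_univ, mul_one]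
    _ ≤ _ := measure_mono fun x hx => h x.1 x.2 hx.1

lemma prod_le_measure_of_imp [SFinite μ] [IsProbabilityMeasure ν]
    {A : Set (Site → Bool)} {B : Set ((Site → Bool) × (Site → Bool))}
    (h : ∀ η α, (η, α) ∈ B → η ∈ A) : (μ.prod ν) B ≤ μ A := by
  calc _ ≤ (μ.prod ν) (A ×ˢ univ) := measure_mono fun x hx => ⟨h x.1 x.2 hx, trivial⟩
    _ = μ A := by rw [Measure.prod_prod, measure_univ, mul_one]

lemma measure_connectedIn_le_enhanced (hμ : IsBernoulli p μ) [IsProbabilityMeasure ν] (x : Site) :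
    μ {η | ConnectedIn adjZ2 (toConfig η) 0 x} ≤
      (μ.prod ν) {ηα | ConnectedIn adjZ2 (enhanced φ (toConfig ηα.1) ηα.2) 0 x} :=
  haveI := hμ.1
  measure_le_prod_of_imp fun _ _ h => ConnectedIn.mono (subset_enhanced _ _) h

lemma measure_inInfiniteCluster_le_enhanced (hμ : IsBernoulli p μ) [IsProbabilityMeasure ν] :
    μ {η | InInfiniteCluster adjZ2 (toConfig η) 0} ≤
      (μ.prod ν) {ηα | InInfiniteCluster adjZ2 (enhanced φ (toConfig ηα.1) ηα.2) 0} :=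
  haveI := hμ.1
  measure_le_prod_of_imp fun _ _ h =>
    Set.Infinite.mono (fun _ hy => ConnectedIn.mono (subset_enhanced _ _) hy) h

/-- The number of sites that are opened in the comparison. -/
def comparisonExponent (N : ℕ) : ℕ := 2 * (2 * (2 * N) + 1) ^ 2

lemma enhanced_connectedIn_le (hφ : IsEnhancement R₀ φ) (hmono : Monotonic φ)
    (hness : ¬ Essential adjZ2 φ) (hN : R₀ < N) (hp : p ≤ 1) (hμ : IsBernoulli p μ)
    [IsProbabilityMeasure ν] (x : Site) :
    ENNReal.ofReal p ^ comparisonExponent N *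
        (μ.prod ν) {ηα | ConnectedIn adjZ2 (enhanced φ (toConfig ηα.1) ηα.2) 0 x} ≤
      μ {η | ConnectedIn adjZ2 (toConfig η) 0 x} := by
  have := hμ.1
  set F := boxAt (2 * N) 0 ∪ boxAt (2 * N) x with hF
  have hcard : F.card ≤ comparisonExponent N := by
    refine (Finset.card_union_le _ _).trans ?_
    rw [card_boxAt, card_boxAt, comparisonExponent, two_mul (_ ^ 2)]
  refine le_trans ?_ (measure_openOn_le hμ F (measurableSet_connectedIn 0 x))
  refine mul_le_mul' (pow_le_pow_right_of_le_one' (by simpa using hp) hcard) ?_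
  refine prod_le_measure_of_imp fun η α h => ?_
  have h' := connectedIn_of_enhanced hφ hmono hness hN h
  rw [← Finset.coe_union, ← toConfig_openOn] at h'
  exact h'

lemma enhanced_inInfiniteCluster_le (hφ : IsEnhancement R₀ φ) (hmono : Monotonic φ)
    (hness : ¬ Essential adjZ2 φ) (hN : R₀ < N) (hp : p ≤ 1) (hμ : IsBernoulli p μ)
    [IsProbabilityMeasure ν] :
    ENNReal.ofReal p ^ comparisonExponent N *
        (μ.prod ν) {ηα | InInfiniteCluster adjZ2 (enhanced φ (toConfig ηα.1) ηα.2) 0} ≤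
      μ {η | InInfiniteCluster adjZ2 (toConfig η) 0} := by
  have := hμ.1
  have hcard : (boxAt (2 * N) 0).card ≤ comparisonExponent N := by
    rw [card_boxAt, comparisonExponent]
    exact Nat.le_mul_of_pos_left _ two_pos
  refine le_trans ?_ (measure_openOn_le hμ (boxAt (2 * N) 0) (measurableSet_inInfiniteCluster 0))
  refine mul_le_mul' (pow_le_pow_right_of_le_one' (by simpa using hp) hcard) ?_
  refine prod_le_measure_of_imp fun η α h => ?_
  have h' := inInfiniteCluster_of_enhanced hφ hmono hness hN h
  rw [← toConfig_openOn] at h'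
  exact h'

lemma toReal_le_of_ofReal_pow_mul_le {a b : ℝ≥0∞} (hb : b ≠ ∞) {k : ℕ} (hp : 0 < p)
    (h : ENNReal.ofReal p ^ k * a ≤ b) : a.toReal ≤ (p ^ k)⁻¹ * b.toReal := by
  have h1 := ENNReal.toReal_mono hb h
  rw [ENNReal.toReal_mul, ENNReal.toReal_pow, ENNReal.toReal_ofReal hp.le] at h1
  rw [inv_mul_eq_div, le_div_iff₀ (pow_pos hp k), mul_comm]
  exact h1

lemma tau_le_tauEnh (hμ : IsBernoulli p μ) [IsProbabilityMeasure ν] (x : Site) :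
    tau adjZ2 μ x ≤ tauEnh adjZ2 φ μ ν x :=
  haveI := hμ.1
  ENNReal.toReal_mono (measure_ne_top _ _) (measure_connectedIn_le_enhanced hμ x)

lemma theta_le_thetaEnh (hμ : IsBernoulli p μ) [IsProbabilityMeasure ν] :
    theta adjZ2 μ ≤ thetaEnh adjZ2 φ μ ν :=
  haveI := hμ.1
  ENNReal.toReal_mono (measure_ne_top _ _) (measure_inInfiniteCluster_le_enhanced hμ)

lemma tauEnh_le (hφ : IsEnhancement R₀ φ) (hmono : Monotonic φ)
    (hness : ¬ Essential adjZ2 φ) (hN : R₀ < N) (hp : 0 < p) (hp1 : p ≤ 1)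
    (hμ : IsBernoulli p μ) [IsProbabilityMeasure ν] (x : Site) :
    tauEnh adjZ2 φ μ ν x ≤ (p ^ comparisonExponent N)⁻¹ * tau adjZ2 μ x :=
  haveI := hμ.1
  toReal_le_of_ofReal_pow_mul_le (measure_ne_top _ _) hp
    (enhanced_connectedIn_le hφ hmono hness hN hp1 hμ x)

lemma thetaEnh_le (hφ : IsEnhancement R₀ φ) (hmono : Monotonic φ)
    (hness : ¬ Essential adjZ2 φ) (hN : R₀ < N) (hp : 0 < p) (hp1 : p ≤ 1)
    (hμ : IsBernoulli p μ) [IsProbabilityMeasure ν] :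
    thetaEnh adjZ2 φ μ ν ≤ (p ^ comparisonExponent N)⁻¹ * theta adjZ2 μ :=
  haveI := hμ.1
  toReal_le_of_ofReal_pow_mul_le (measure_ne_top _ _) hp
    (enhanced_inInfiniteCluster_le hφ hmono hness hN hp1 hμ)

lemma chi_le_chiEnh (hμ : IsBernoulli p μ) [IsProbabilityMeasure ν] :
    chi adjZ2 μ ≤ chiEnh adjZ2 φ μ ν :=
  ENNReal.tsum_le_tsum fun x => measure_connectedIn_le_enhanced hμ x

lemma chiEnh_le (hφ : IsEnhancement R₀ φ) (hmono : Monotonic φ)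
    (hness : ¬ Essential adjZ2 φ) (hN : R₀ < N) (hp1 : p ≤ 1)
    (hμ : IsBernoulli p μ) [IsProbabilityMeasure ν] :
    ENNReal.ofReal p ^ comparisonExponent N * chiEnh adjZ2 φ μ ν ≤ chi adjZ2 μ := by
  rw [chiEnh, ← ENNReal.tsum_mul_left]
  exact ENNReal.tsum_le_tsum fun x => enhanced_connectedIn_le hφ hmono hness hN hp1 hμ x

/-- The mean cluster sizes are both infinite or comparable. -/
lemma chi_toReal_compare (hφ : IsEnhancement R₀ φ) (hmono : Monotonic φ)
    (hness : ¬ Essential adjZ2 φ) (hN : R₀ < N) (hp : 0 < p) (hp1 : p ≤ 1)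
    (hμ : IsBernoulli p μ) [IsProbabilityMeasure ν] :
    (chi adjZ2 μ).toReal ≤ (chiEnh adjZ2 φ μ ν).toReal ∧
      (chiEnh adjZ2 φ μ ν).toReal ≤
        (p ^ comparisonExponent N)⁻¹ * (chi adjZ2 μ).toReal := by
  have hle : chi adjZ2 μ ≤ chiEnh adjZ2 φ μ ν := chi_le_chiEnh hμ
  have hge := chiEnh_le (ν := ν) hφ hmono hness hN hp1 hμ
  by_cases htop : chi adjZ2 μ = ∞
  · rw [htop, top_le_iff] at hle
    simp [htop, hle]
  · have hne : chiEnh adjZ2 φ μ ν ≠ ∞ := by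
      intro h
      rw [h, ENNReal.mul_top (pow_ne_zero _ (by simpa using hp))] at hge
      exact htop (top_le_iff.1 hge)
    exact ⟨ENNReal.toReal_mono hne hle, toReal_le_of_ofReal_pow_mul_le htop hp hge⟩

end Comparison

/-! ### The critical point is positive -/

/-- The four unit steps of the lattice. -/
def unitSteps : Finset Site := {(1, 0), (-1, 0), (0, 1), (0, -1)}

/-- The site sets of `n`-step walks started at the origin, together with their endpoints. -/
def walkSets : ℕ → Finset (Finset Site × Site)
  | 0 => {({0}, 0)}
  | n + 1 => (walkSets n ×ˢ unitSteps).image fun q => (insert (q.1.2 + q.2) q.1.1, q.1.2 + q.2)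

lemma card_walkSets_le (n : ℕ) : (walkSets n).card ≤ 4 ^ n := by
  induction n with
  | zero => simp [walkSets]
  | succ n ih =>
    refine Finset.card_image_le.trans ?_
    rw [Finset.card_product, pow_succ]
    exact Nat.mul_le_mul ih (by decide)

lemma mem_walkSets {f : ℕ → Site} (f0 : f 0 = 0) {n : ℕ}
    (hf : ∀ i < n, adjZ2 (f i) (f (i + 1))) :
    ((Finset.range (n + 1)).image f, f n) ∈ walkSets n := by
  induction n with
  | zero => simp [walkSets, f0]
  | succ n ih =>
    have hstep : f (n + 1) - f n ∈ unitSteps := by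
      have := hf n (Nat.lt_succ_self n)
      rw [adjZ2_iff] at this
      simp only [unitSteps, Finset.mem_insert, Finset.mem_singleton, Prod.ext_iff, Prod.fst_sub,
        Prod.snd_sub]
      omega
    refine Finset.mem_image.2 ⟨(((Finset.range (n + 1)).image f, f n), f (n + 1) - f n),
      Finset.mem_product.2 ⟨ih fun i hi => hf i (by omega), hstep⟩, ?_⟩
    simp only [add_sub_cancel]
    rw [Finset.range_add_one (n := n + 1), Finset.image_insert]

lemma exists_walkSet_of_infinite {ω : Config} (h : InInfiniteCluster adjZ2 ω 0) (n : ℕ) :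
    ∃ q ∈ walkSets n, q.1.card = n + 1 ∧ ∀ z ∈ q.1, z ∈ ω := by
  obtain ⟨y, hy, hyn⟩ : ∃ y, ConnectedIn adjZ2 ω 0 y ∧ n < supNorm y := by
    by_contra! hcon
    exact h ((finite_supNorm_le n).subset hcon)
  obtain ⟨h0, hr⟩ := connectedIn_iff.1 hy
  obtain ⟨m, f, f0, fm, fω, fadj, finj, -⟩ := exists_geodesic h0 hr
  have hnorm : ∀ i ≤ m, supNorm (f i) ≤ i := by
    intro i
    induction i with
    | zero => intro _; simp [f0, supNorm]
    | succ i ih =>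
      intro hi
      have h1 := supNorm_le_of_adj (fadj i (by omega))
      have h2 := ih (by omega)
      omega
  have hm : n < m := by
    have := hnorm m le_rfl
    rw [fm] at this
    omega
  refine ⟨_, mem_walkSets f0 (n := n) fun i hi => fadj i (by omega), ?_, ?_⟩
  · rw [Finset.card_image_of_injOn, Finset.card_range]
    intro i hi j hj hij
    simp only [Finset.coe_range, mem_Iio] at hi hj
    exact finj i j (by omega) (by omega) hij
  · intro z hz
    obtain ⟨i, -, rfl⟩ := Finset.mem_image.1 hz
    exact fω i

lemma theta_eq_zero_of_le {p : ℝ} (hp : p ≤ 1 / 8) {μ : Measure (Site → Bool)}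
    (hμ : IsBernoulli p μ) : theta adjZ2 μ = 0 := by
  have hp' : ENNReal.ofReal p ≤ 8⁻¹ := by
    calc ENNReal.ofReal p ≤ ENNReal.ofReal (1 / 8) := ENNReal.ofReal_le_ofReal hp
      _ = 8⁻¹ := by rw [one_div, ENNReal.ofReal_inv_of_pos (by norm_num)]; norm_num
  have hbound : ∀ n : ℕ, μ {η | InInfiniteCluster adjZ2 (toConfig η) 0} ≤ 2⁻¹ ^ n := by
    intro n
    set W := (walkSets n).filter fun q => q.1.card = n + 1
    calc μ {η | InInfiniteCluster adjZ2 (toConfig η) 0}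
        ≤ μ (⋃ q ∈ W, allOpen q.1) := by
          refine measure_mono fun η hη => ?_
          obtain ⟨q, hq, hqc, hqω⟩ := exists_walkSet_of_infinite hη n
          exact mem_iUnion₂.2 ⟨q, Finset.mem_filter.2 ⟨hq, hqc⟩, hqω⟩
      _ ≤ ∑ q ∈ W, μ (allOpen q.1) := measure_biUnion_finset_le _ _
      _ ≤ ∑ q ∈ W, 8⁻¹ ^ n := by
          refine Finset.sum_le_sum fun q hq => ?_
          rw [measure_allOpen hμ, (Finset.mem_filter.1 hq).2]
          refine (pow_le_pow_left' hp' _).trans ?_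
          exact pow_le_pow_right_of_le_one' (by simp) n.le_succ
      _ ≤ 4 ^ n * 8⁻¹ ^ n := by
          rw [Finset.sum_const, nsmul_eq_mul]
          gcongr
          exact_mod_cast (Finset.card_filter_le _ _).trans (card_walkSets_le n)
      _ = 2⁻¹ ^ n := by
          rw [← mul_pow]
          congr 1
          rw [← ENNReal.toReal_eq_toReal_iff' (by finiteness) (by finiteness)]
          norm_num
  have h0 : μ {η | InInfiniteCluster adjZ2 (toConfig η) 0} = 0 :=
    le_antisymm (ge_of_tendsto' (ENNReal.tendsto_pow_atTop_nhds_zero_of_lt_one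
      (by simp)) hbound) bot_le
  rw [theta, h0, ENNReal.toReal_zero]

/-! ### The critical point is less than one -/

/-- The nine sub-blocks of a block in the hierarchical decomposition into triadic squares. -/
noncomputable def children (b : Site) : Finset Site :=
  Finset.Icc (3 * b.1) (3 * b.1 + 2) ×ˢ Finset.Icc (3 * b.2) (3 * b.2 + 2)

lemma mem_children {b c : Site} : c ∈ children b ↔
    (3 * b.1 ≤ c.1 ∧ c.1 ≤ 3 * b.1 + 2) ∧ 3 * b.2 ≤ c.2 ∧ c.2 ≤ 3 * b.2 + 2 := by
  simp [children]

lemma card_children (b : Site) : (children b).card = 9 := by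
  have h : ∀ a : ℤ, (a + 2 + 1 - a).toNat = 3 := fun a => by omega
  simp only [children, Finset.card_product, Int.card_Icc, h]

/-- A block of level `0` is bad if its site is closed; a block of level `n + 1` is bad if at least
two of its sub-blocks are bad. -/
def BadBlock (η : Site → Bool) : ℕ → Site → Prop
  | 0, b => η b = false
  | n + 1, b => ∃ c ∈ children b, ∃ c' ∈ children b, c ≠ c' ∧ BadBlock η n c ∧ BadBlock η n c'

/-- The sites of a block that are reached through good sub-blocks at all levels. -/
def blockCore (η : Site → Bool) : ℕ → Site → Set Site
  | 0, b => {b}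
  | n + 1, b => {z | ∃ c ∈ children b, ¬ BadBlock η n c ∧ z ∈ blockCore η n c}

/-- All core sites of the two blocks are connected. -/
def BlocksLinked (η : Site → Bool) (n : ℕ) (b b' : Site) : Prop :=
  ∀ x ∈ blockCore η n b, ∀ y ∈ blockCore η n b', (siteGraph (toConfig η)).Reachable x y

lemma exists_good_child {η : Site → Bool} {n : ℕ} {b c c' : Site} (hb : ¬ BadBlock η (n + 1) b)
    (hc : c ∈ children b) (hc' : c' ∈ children b) (hne : c ≠ c') :
    ¬ BadBlock η n c ∨ ¬ BadBlock η n c' := by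
  by_contra! hcon
  exact hb ⟨c, hc, c', hc', hne, hcon.1, hcon.2⟩

lemma blockCore_nonempty {η : Site → Bool} (n : ℕ) {b : Site} (hb : ¬ BadBlock η n b) :
    (blockCore η n b).Nonempty := by
  induction n generalizing b with
  | zero => exact ⟨b, rfl⟩
  | succ n ih =>
    have h1 : ((3 * b.1, 3 * b.2) : Site) ∈ children b := by rw [mem_children]; simp
    have h2 : ((3 * b.1 + 1, 3 * b.2) : Site) ∈ children b := by rw [mem_children]; simp
    rcases exists_good_child hb h1 h2 (by simp) with h | h
    · obtain ⟨z, hz⟩ := ih h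
      exact ⟨z, _, h1, h, hz⟩
    · obtain ⟨z, hz⟩ := ih h
      exact ⟨z, _, h2, h, hz⟩

lemma BlocksLinked.trans {η : Site → Bool} {n : ℕ} {b₁ b₂ b₃ : Site} (hb : ¬ BadBlock η n b₂)
    (h : BlocksLinked η n b₁ b₂) (h' : BlocksLinked η n b₂ b₃) : BlocksLinked η n b₁ b₃ := by
  obtain ⟨z, hz⟩ := blockCore_nonempty n hb
  exact fun x hx y hy => (h x hx z hz).trans (h' z hz y hy)

/-- The `3 × 3` square with lower left corner `(a, b)`, with the site `d` removed. -/
def puncturedSquare (a b : ℤ) (d : Site) : Set Site :=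
  {c | (a ≤ c.1 ∧ c.1 ≤ a + 2) ∧ (b ≤ c.2 ∧ c.2 ≤ b + 2) ∧ ¬ (c.1 = d.1 ∧ c.2 = d.2)}

lemma reachable_puncturedSquare {a b : ℤ} {d c c' : Site} (hc : c ∈ puncturedSquare a b d)
    (hc' : c' ∈ puncturedSquare a b d) : (siteGraph (puncturedSquare a b d)).Reachable c c' := by
  have adj : ∀ x y : Site, x ∈ puncturedSquare a b d → y ∈ puncturedSquare a b d →
      ((x.1 = y.1 ∧ (x.2 = y.2 + 1 ∨ y.2 = x.2 + 1)) ∨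
        (x.2 = y.2 ∧ (x.1 = y.1 + 1 ∨ y.1 = x.1 + 1))) →
      (siteGraph (puncturedSquare a b d)).Reachable x y :=
    fun x y hx hy hxy => SimpleGraph.Adj.reachable ⟨adjZ2_iff.2 hxy, hx, hy⟩
  suffices H : ∃ h : Site, ∀ c ∈ puncturedSquare a b d,
      (siteGraph (puncturedSquare a b d)).Reachable c h by
    obtain ⟨h, hh⟩ := H
    exact (hh c hc).trans (hh c' hc').symm
  clear hc hc' c c'
  by_cases hd : d.1 = a + 1 ∧ d.2 = b + 1
  · refine ⟨(a, b), fun c hc => ?_⟩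
    have m : ∀ i j : ℤ, 0 ≤ i → i ≤ 2 → 0 ≤ j → j ≤ 2 → ¬ (i = 1 ∧ j = 1) →
        ((a + i, b + j) : Site) ∈ puncturedSquare a b d := by
      intro i j _ _ _ _ _
      exact ⟨⟨by dsimp only; omega, by dsimp only; omega⟩,
        ⟨by dsimp only; omega, by dsimp only; omega⟩, by dsimp only; omega⟩
    have r0 : (siteGraph (puncturedSquare a b d)).Reachable (a + 0, b + 0) (a, b) := by
      rw [add_zero, add_zero]
    have r1 := (adj _ _ (m 1 0 (by simp) (by simp) (by simp) (by simp) (by simp))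
      (m 0 0 (by simp) (by simp) (by simp) (by simp) (by simp)) (by dsimp only; omega)).trans r0
    have r2 := (adj _ _ (m 2 0 (by simp) (by simp) (by simp) (by simp) (by simp))
      (m 1 0 (by simp) (by simp) (by simp) (by simp) (by simp)) (by dsimp only; omega)).trans r1
    have r3 := (adj _ _ (m 2 1 (by simp) (by simp) (by simp) (by simp) (by simp))
      (m 2 0 (by simp) (by simp) (by simp) (by simp) (by simp)) (by dsimp only; omega)).trans r2
    have r4 := (adj _ _ (m 2 2 (by simp) (by simp) (by simp) (by simp) (by simp))
      (m 2 1 (by simp) (by simp) (by simp) (by simp) (by simp)) (by dsimp only; omega)).trans r3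
    have r5 := (adj _ _ (m 1 2 (by simp) (by simp) (by simp) (by simp) (by simp))
      (m 2 2 (by simp) (by simp) (by simp) (by simp) (by simp)) (by dsimp only; omega)).trans r4
    have r6 := (adj _ _ (m 0 2 (by simp) (by simp) (by simp) (by simp) (by simp))
      (m 1 2 (by simp) (by simp) (by simp) (by simp) (by simp)) (by dsimp only; omega)).trans r5
    have r7 := (adj _ _ (m 0 1 (by simp) (by simp) (by simp) (by simp) (by simp))
      (m 0 2 (by simp) (by simp) (by simp) (by simp) (by simp)) (by dsimp only; omega)).trans r6
    obtain ⟨c₁, c₂⟩ := c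
    obtain ⟨⟨h1, h2⟩, ⟨h3, h4⟩, h5⟩ := hc
    dsimp only at h1 h2 h3 h4 h5
    obtain ⟨i, rfl⟩ : ∃ i, c₁ = a + i := ⟨c₁ - a, by ring⟩
    obtain ⟨j, rfl⟩ : ∃ j, c₂ = b + j := ⟨c₂ - b, by ring⟩
    have hi : i = 0 ∨ i = 1 ∨ i = 2 := by omega
    have hj : j = 0 ∨ j = 1 ∨ j = 2 := by omega
    rcases hi with rfl | rfl | rfl <;> rcases hj with rfl | rfl | rfl <;>
      first | assumption | omega
  · have hm : ((a + 1, b + 1) : Site) ∈ puncturedSquare a b d :=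
      ⟨by dsimp only; omega, by dsimp only; omega, by dsimp only; omega⟩
    have near : ∀ c ∈ puncturedSquare a b d, c.1 = a + 1 ∨ c.2 = b + 1 →
        (siteGraph (puncturedSquare a b d)).Reachable c (a + 1, b + 1) := by
      intro c hc hcm
      by_cases heq : c.1 = a + 1 ∧ c.2 = b + 1
      · rw [show c = (a + 1, b + 1) from Prod.ext heq.1 heq.2]
      · refine adj _ _ hc hm ?_
        obtain ⟨h1, h2, h3⟩ := hc
        dsimp only
        omega
    refine ⟨(a + 1, b + 1), fun c hc => ?_⟩
    by_cases hcm : c.1 = a + 1 ∨ c.2 = b + 1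
    · exact near c hc hcm
    · have hc' := hc
      obtain ⟨h1, h2, h3⟩ := hc'
      by_cases hd' : d.1 = a + 1 ∧ d.2 = c.2
      · have hmem : ((c.1, b + 1) : Site) ∈ puncturedSquare a b d :=
          ⟨by dsimp only; omega, by dsimp only; omega, by dsimp only; omega⟩
        exact (adj _ _ hc hmem (by dsimp only; omega)).trans (near _ hmem (Or.inr rfl))
      · have hmem : ((a + 1, c.2) : Site) ∈ puncturedSquare a b d :=
          ⟨by dsimp only; omega, by dsimp only; omega, by dsimp only; omega⟩
        exact (adj _ _ hc hmem (by dsimp only; omega)).trans (near _ hmem (Or.inl rfl))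

lemma linked_children {η : Site → Bool} {n : ℕ}
    (ih : ∀ b b', ¬ BadBlock η n b → ¬ BadBlock η n b' → b = b' ∨ adjZ2 b b' →
      BlocksLinked η n b b')
    {b c c' : Site} (hb : ¬ BadBlock η (n + 1) b) (hc : c ∈ children b) (hc' : c' ∈ children b)
    (hcg : ¬ BadBlock η n c) (hcg' : ¬ BadBlock η n c') : BlocksLinked η n c c' := by
  obtain ⟨d, hd, hcd, hcd'⟩ : ∃ d : Site,
      (∀ z ∈ puncturedSquare (3 * b.1) (3 * b.2) d, ¬ BadBlock η n z) ∧ c ≠ d ∧ c' ≠ d := by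
    by_cases h : ∃ d ∈ children b, BadBlock η n d
    · obtain ⟨d, hd, hdb⟩ := h
      refine ⟨d, fun z hz hzb => hb ⟨z, mem_children.2 ⟨hz.1, hz.2.1⟩, d, hd, ?_, hzb, hdb⟩,
        fun h => hcg (h ▸ hdb), fun h => hcg' (h ▸ hdb)⟩
      rintro rfl
      exact hz.2.2 ⟨rfl, rfl⟩
    · push Not at h
      rw [mem_children] at hc hc'
      refine ⟨(3 * b.1 - 1, 0), fun z hz => h z (mem_children.2 ⟨hz.1, hz.2.1⟩), ?_, ?_⟩ <;>
        rw [Ne, Prod.ext_iff] <;> dsimp only <;> omega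
  have hmem : ∀ z ∈ children b, z ≠ d → z ∈ puncturedSquare (3 * b.1) (3 * b.2) d := by
    intro z hz hzd
    rw [mem_children] at hz
    exact ⟨hz.1, hz.2, fun h => hzd (Prod.ext h.1 h.2)⟩
  have hr := reachable_puncturedSquare (hmem c hc hcd) (hmem c' hc' hcd')
  clear hc' hcg' hcd'
  rw [SimpleGraph.reachable_iff_reflTransGen] at hr
  induction hr with
  | refl => exact ih c c hcg hcg (Or.inl rfl)
  | tail _ hadj ih' =>
    exact ih'.trans (hd _ hadj.2.1) (ih _ _ (hd _ hadj.2.1) (hd _ hadj.2.2) (Or.inr hadj.1))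

lemma exists_adj_good_children {η : Site → Bool} {n : ℕ} {b b' : Site}
    (hb : ¬ BadBlock η (n + 1) b) (hb' : ¬ BadBlock η (n + 1) b') (hadj : adjZ2 b b') :
    ∃ c ∈ children b, ∃ c' ∈ children b', ¬ BadBlock η n c ∧ ¬ BadBlock η n c' ∧ adjZ2 c c' := by
  suffices H : ∃ f f' : ℕ → Site, (∀ j ≤ 2, f j ∈ children b ∧ f' j ∈ children b' ∧
      adjZ2 (f j) (f' j)) ∧ Function.Injective f ∧ Function.Injective f' by
    obtain ⟨f, f', hf, finj, finj'⟩ := H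
    by_contra! hcon
    have hbad : ∀ j ≤ 2, BadBlock η n (f j) ∨ BadBlock η n (f' j) := by
      intro j hj
      by_contra! h
      exact hcon _ (hf j hj).1 _ (hf j hj).2.1 h.1 h.2 (hf j hj).2.2
    have hbb : ∀ i ≤ 2, ∀ j ≤ 2, i ≠ j → ¬ (BadBlock η n (f i) ∧ BadBlock η n (f j)) :=
      fun i hi j hj hij h => hb ⟨_, (hf i hi).1, _, (hf j hj).1, finj.ne hij, h.1, h.2⟩
    have hbb' : ∀ i ≤ 2, ∀ j ≤ 2, i ≠ j → ¬ (BadBlock η n (f' i) ∧ BadBlock η n (f' j)) :=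
      fun i hi j hj hij h => hb' ⟨_, (hf i hi).2.1, _, (hf j hj).2.1, finj'.ne hij, h.1, h.2⟩
    have h0 := hbad 0 (by simp)
    have h1 := hbad 1 (by simp)
    have h2 := hbad 2 (by simp)
    have a1 := hbb 0 (by simp) 1 (by simp) (by simp)
    have a2 := hbb 0 (by simp) 2 (by simp) (by simp)
    have a3 := hbb 1 (by simp) 2 (by simp) (by simp)
    have b1 := hbb' 0 (by simp) 1 (by simp) (by simp)
    have b2 := hbb' 0 (by simp) 2 (by simp) (by simp)
    have b3 := hbb' 1 (by simp) 2 (by simp) (by simp)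
    tauto
  have hinj : ∀ u : ℤ, (∀ v : ℤ, Function.Injective fun j : ℕ => ((u, v + j) : Site)) ∧
      ∀ v : ℤ, Function.Injective fun j : ℕ => ((v + j, u) : Site) := by
    refine fun u => ⟨fun v i j h => ?_, fun v i j h => ?_⟩ <;>
    · simp only [Prod.mk.injEq] at h
      omega
  simp only [mem_children]
  rw [adjZ2_iff] at hadj
  rcases hadj with ⟨h, h' | h'⟩ | ⟨h, h' | h'⟩
  · refine ⟨fun j => (3 * b.1 + j, 3 * b.2), fun j => (3 * b.1 + j, 3 * b.2 - 1), fun j hj => ?_,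
      (hinj _).2 _, (hinj _).2 _⟩
    rw [adjZ2_iff]; dsimp only; omega
  · refine ⟨fun j => (3 * b.1 + j, 3 * b.2 + 2), fun j => (3 * b.1 + j, 3 * b.2 + 3),
      fun j hj => ?_, (hinj _).2 _, (hinj _).2 _⟩
    rw [adjZ2_iff]; dsimp only; omega
  · refine ⟨fun j => (3 * b.1, 3 * b.2 + j), fun j => (3 * b.1 - 1, 3 * b.2 + j), fun j hj => ?_,
      (hinj _).1 _, (hinj _).1 _⟩
    rw [adjZ2_iff]; dsimp only; omega
  · refine ⟨fun j => (3 * b.1 + 2, 3 * b.2 + j), fun j => (3 * b.1 + 3, 3 * b.2 + j),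
      fun j hj => ?_, (hinj _).1 _, (hinj _).1 _⟩
    rw [adjZ2_iff]; dsimp only; omega

/-- The cores of equal or adjacent good blocks are connected. -/
lemma blocksLinked_of_good {η : Site → Bool} (n : ℕ) (b b' : Site) (hb : ¬ BadBlock η n b)
    (hb' : ¬ BadBlock η n b') (h : b = b' ∨ adjZ2 b b') : BlocksLinked η n b b' := by
  induction n generalizing b b' with
  | zero =>
    rintro x hx y hy
    obtain rfl : x = b := hx
    obtain rfl : y = b' := hy
    rcases h with rfl | h
    · exact SimpleGraph.Reachable.refl _
    · exact SimpleGraph.Adj.reachable ⟨h, by simpa [BadBlock, toConfig] using hb,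
        by simpa [BadBlock, toConfig] using hb'⟩
  | succ n ih =>
    rintro x ⟨c, hc, hcg, hx⟩ y ⟨c', hc', hcg', hy⟩
    rcases h with rfl | h
    · exact linked_children ih hb hc hc' hcg hcg' x hx y hy
    · obtain ⟨e, he, e', he', heg, heg', hadj⟩ := exists_adj_good_children hb hb' h
      exact ((linked_children ih hb hc he hcg heg).trans heg
        ((ih e e' heg heg' (Or.inr hadj)).trans heg'
          (linked_children ih hb' he' hc' heg' hcg'))) x hx y hy

lemma le_fst_of_mem_blockCore {η : Site → Bool} (n : ℕ) {b z : Site} (hz : z ∈ blockCore η n b) :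
    3 ^ n * b.1 ≤ z.1 := by
  induction n generalizing b with
  | zero =>
    obtain rfl : z = b := hz
    simp
  | succ n ih =>
    obtain ⟨c, hc, -, hz⟩ := hz
    have h1 := ih hz
    have h2 := (mem_children.1 hc).1.1
    have h3 : (3 : ℤ) ^ n * (3 * b.1) ≤ 3 ^ n * c.1 := by gcongr
    calc (3 : ℤ) ^ (n + 1) * b.1 = 3 ^ n * (3 * b.1) := by ring
      _ ≤ z.1 := h3.trans h1

lemma inInfiniteCluster_of_good {η : Site → Bool} (h : ∀ n, ¬ BadBlock η n 0) :
    InInfiniteCluster adjZ2 (toConfig η) 0 := by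
  have h0 : ∀ n, (0 : Site) ∈ blockCore η n 0 := by
    intro n
    induction n with
    | zero => rfl
    | succ n ih => exact ⟨0, by simp [mem_children], h n, ih⟩
  have hopen : (0 : Site) ∈ toConfig η := by simpa [BadBlock, toConfig] using h 0
  refine Set.Infinite.of_image Prod.fst (Set.infinite_of_not_bddAbove ?_)
  rintro ⟨M, hM⟩
  obtain ⟨n, hn⟩ : ∃ n : ℕ, M < 3 ^ n := pow_unbounded_of_one_lt M (by norm_num)
  have hc1 : ((1, 1) : Site) ∈ children 0 := by simp [mem_children]
  have hc2 : ((2, 2) : Site) ∈ children 0 := by simp [mem_children]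
  obtain ⟨c, hc, hcg, hc1⟩ : ∃ c ∈ children 0, ¬ BadBlock η n c ∧ 1 ≤ c.1 := by
    rcases exists_good_child (h (n + 1)) hc1 hc2 (by simp) with hg | hg
    · exact ⟨_, hc1, hg, le_rfl⟩
    · exact ⟨_, hc2, hg, by norm_num⟩
  obtain ⟨z, hz⟩ := blockCore_nonempty n hcg
  have hr := blocksLinked_of_good (n + 1) 0 0 (h _) (h _) (Or.inl rfl) 0 (h0 _) z ⟨c, hc, hcg, hz⟩
  have hzM : z.1 ≤ M := hM ⟨z, connectedIn_iff.2 ⟨hopen, hr⟩, rfl⟩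
  have hz1 := le_fst_of_mem_blockCore n hz
  have : (3 : ℤ) ^ n * 1 ≤ 3 ^ n * c.1 := by gcongr
  omega

/-- The sets of sites whose closedness can witness that a block is bad. -/
noncomputable def badWitnesses : ℕ → Site → Finset (Finset Site)
  | 0, b => {{b}}
  | n + 1, b => ((children b ×ˢ children b).filter fun q => q.1 ≠ q.2).biUnion fun q =>
      (badWitnesses n q.1 ×ˢ badWitnesses n q.2).image fun F => F.1 ∪ F.2

lemma mem_badWitnesses_succ {n : ℕ} {b : Site} {F : Finset Site} :
    F ∈ badWitnesses (n + 1) b ↔ ∃ c ∈ children b, ∃ c' ∈ children b, c ≠ c' ∧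
      ∃ G ∈ badWitnesses n c, ∃ G' ∈ badWitnesses n c', G ∪ G' = F := by
  simp only [badWitnesses, Finset.mem_biUnion, Finset.mem_filter, Finset.mem_product,
    Finset.mem_image]
  constructor
  · rintro ⟨⟨c, c'⟩, ⟨⟨hc, hc'⟩, hne⟩, ⟨G, G'⟩, ⟨hG, hG'⟩, h⟩
    exact ⟨c, hc, c', hc', hne, G, hG, G', hG', h⟩
  · rintro ⟨c, hc, c', hc', hne, G, hG, G', hG', h⟩
    exact ⟨(c, c'), ⟨⟨hc, hc'⟩, hne⟩, (G, G'), ⟨hG, hG'⟩, h⟩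

lemma card_badWitnesses_le (n : ℕ) (b : Site) : (badWitnesses n b).card ≤ 81 ^ (2 ^ n - 1) := by
  induction n generalizing b with
  | zero => simp [badWitnesses]
  | succ n ih =>
    have h1 : (2 : ℕ) ^ (n + 1) - 1 = 1 + ((2 ^ n - 1) + (2 ^ n - 1)) := by
      have : 1 ≤ 2 ^ n := Nat.one_le_two_pow
      rw [pow_succ]; omega
    rw [h1, pow_add, pow_one, pow_add]
    refine (Finset.card_biUnion_le_card_mul _ _ (81 ^ (2 ^ n - 1) * 81 ^ (2 ^ n - 1))
      fun q _ => ?_).trans ?_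
    · refine Finset.card_image_le.trans ?_
      rw [Finset.card_product]
      exact Nat.mul_le_mul (ih _) (ih _)
    · refine Nat.mul_le_mul_right _ ((Finset.card_filter_le _ _).trans ?_)
      rw [Finset.card_product, card_children]

lemma bounds_of_mem_badWitnesses (n : ℕ) {b z : Site} {F : Finset Site}
    (hF : F ∈ badWitnesses n b) (hz : z ∈ F) :
    (3 ^ n * b.1 ≤ z.1 ∧ z.1 < 3 ^ n * (b.1 + 1)) ∧
      3 ^ n * b.2 ≤ z.2 ∧ z.2 < 3 ^ n * (b.2 + 1) := by
  induction n generalizing b F with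
  | zero =>
    obtain rfl : F = {b} := by simpa [badWitnesses] using hF
    obtain rfl : z = b := by simpa using hz
    simp
  | succ n ih =>
    obtain ⟨c, hc, c', hc', -, G, hG, G', hG', rfl⟩ := mem_badWitnesses_succ.1 hF
    obtain ⟨e, he, hez⟩ : ∃ e ∈ children b, (3 ^ n * e.1 ≤ z.1 ∧ z.1 < 3 ^ n * (e.1 + 1)) ∧
        3 ^ n * e.2 ≤ z.2 ∧ z.2 < 3 ^ n * (e.2 + 1) := by
      rcases Finset.mem_union.1 hz with hz | hz
      · exact ⟨c, hc, ih hG hz⟩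
      · exact ⟨c', hc', ih hG' hz⟩
    rw [mem_children] at he
    have low : ∀ s t w : ℤ, 3 * s ≤ t → 3 ^ n * t ≤ w → 3 ^ (n + 1) * s ≤ w := by
      intro s t w hst hw
      have : (3 : ℤ) ^ n * (3 * s) ≤ 3 ^ n * t := by gcongr
      calc (3 : ℤ) ^ (n + 1) * s = 3 ^ n * (3 * s) := by ring
        _ ≤ w := this.trans hw
    have high : ∀ s t w : ℤ, t ≤ 3 * s + 2 → w < 3 ^ n * (t + 1) → w < 3 ^ (n + 1) * (s + 1) := by
      intro s t w hst hw
      have : (3 : ℤ) ^ n * (t + 1) ≤ 3 ^ n * (3 * (s + 1)) := by gcongr; omega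
      calc w < 3 ^ n * (3 * (s + 1)) := hw.trans_le this
        _ = 3 ^ (n + 1) * (s + 1) := by ring
    exact ⟨⟨low _ _ _ he.1.1 hez.1.1, high _ _ _ he.1.2 hez.1.2⟩,
      low _ _ _ he.2.1 hez.2.1, high _ _ _ he.2.2 hez.2.2⟩

lemma card_of_mem_badWitnesses (n : ℕ) {b : Site} {F : Finset Site}
    (hF : F ∈ badWitnesses n b) : F.card = 2 ^ n := by
  induction n generalizing b F with
  | zero =>
    obtain rfl : F = {b} := by simpa [badWitnesses] using hF
    simp
  | succ n ih =>
    obtain ⟨c, hc, c', hc', hne, G, hG, G', hG', rfl⟩ := mem_badWitnesses_succ.1 hF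
    have hlt : ∀ s t w : ℤ, 3 ^ n * s ≤ w → w < 3 ^ n * (t + 1) → s < t + 1 :=
      fun s t w h1 h2 => lt_of_mul_lt_mul_left (h1.trans_lt h2) (by positivity)
    have hdisj : Disjoint G G' := by
      rw [Finset.disjoint_left]
      intro z hz hz'
      obtain ⟨⟨h1, h2⟩, h3, h4⟩ := bounds_of_mem_badWitnesses n hG hz
      obtain ⟨⟨h1', h2'⟩, h3', h4'⟩ := bounds_of_mem_badWitnesses n hG' hz'
      have a1 := hlt _ _ _ h1 h2'
      have a2 := hlt _ _ _ h1' h2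
      have a3 := hlt _ _ _ h3 h4'
      have a4 := hlt _ _ _ h3' h4
      exact hne (Prod.ext (by omega) (by omega))
    rw [Finset.card_union_of_disjoint hdisj, ih hG, ih hG', pow_succ, mul_two]

lemma exists_badWitness {η : Site → Bool} (n : ℕ) {b : Site} (h : BadBlock η n b) :
    ∃ F ∈ badWitnesses n b, ∀ z ∈ F, η z = false := by
  induction n generalizing b with
  | zero => exact ⟨{b}, by simp [badWitnesses], fun z hz => by
      obtain rfl : z = b := by simpa using hz
      exact h⟩
  | succ n ih =>
    obtain ⟨c, hc, c', hc', hne, hb, hb'⟩ := h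
    obtain ⟨G, hG, hGη⟩ := ih hb
    obtain ⟨G', hG', hGη'⟩ := ih hb'
    exact ⟨G ∪ G', mem_badWitnesses_succ.2 ⟨c, hc, c', hc', hne, G, hG, G', hG', rfl⟩,
      fun z hz => (Finset.mem_union.1 hz).elim (hGη z) (hGη' z)⟩

lemma measure_badBlock_le {p : ℝ} (hp : 323 / 324 ≤ p) {μ : Measure (Site → Bool)}
    (hμ : IsBernoulli p μ) (n : ℕ) : μ {η | BadBlock η n 0} ≤ 4⁻¹ ^ (n + 1) := by
  have hp' : ENNReal.ofReal (1 - p) ≤ 324⁻¹ := by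
    calc ENNReal.ofReal (1 - p) ≤ ENNReal.ofReal (1 / 324) :=
          ENNReal.ofReal_le_ofReal (by linarith)
      _ = 324⁻¹ := by rw [one_div, ENNReal.ofReal_inv_of_pos (by norm_num)]; norm_num
  calc μ {η | BadBlock η n 0}
      ≤ μ (⋃ F ∈ badWitnesses n 0, {η | ∀ z ∈ F, η z = false}) := by
        refine measure_mono fun η hη => ?_
        obtain ⟨F, hF, hFη⟩ := exists_badWitness n hη
        exact mem_iUnion₂.2 ⟨F, hF, hFη⟩
    _ ≤ ∑ F ∈ badWitnesses n 0, μ {η | ∀ z ∈ F, η z = false} := measure_biUnion_finset_le _ _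
    _ ≤ ∑ F ∈ badWitnesses n 0, 324⁻¹ ^ 2 ^ n := by
        refine Finset.sum_le_sum fun F hF => ?_
        rw [measure_allClosed hμ, card_of_mem_badWitnesses n hF]
        exact pow_le_pow_left' hp' _
    _ ≤ 81 ^ 2 ^ n * 324⁻¹ ^ 2 ^ n := by
        rw [Finset.sum_const, nsmul_eq_mul]
        gcongr
        exact_mod_cast (card_badWitnesses_le n 0).trans
          (Nat.pow_le_pow_right (by norm_num) (Nat.sub_le _ _))
    _ = 4⁻¹ ^ 2 ^ n := by
        rw [← mul_pow]
        congr 1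
        rw [← ENNReal.toReal_eq_toReal_iff' (by finiteness) (by finiteness)]
        norm_num
    _ ≤ 4⁻¹ ^ (n + 1) := pow_le_pow_right_of_le_one' (by simp) n.lt_two_pow_self

lemma theta_ne_zero_of_ge {p : ℝ} (hp : 323 / 324 ≤ p) {μ : Measure (Site → Bool)}
    (hμ : IsBernoulli p μ) : theta adjZ2 μ ≠ 0 := by
  have := hμ.1
  intro h0
  rw [theta, ENNReal.toReal_eq_zero_iff, or_iff_left (measure_ne_top _ _)] at h0
  have hcompl : univ ⊆ {η | InInfiniteCluster adjZ2 (toConfig η) 0} ∪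
      ⋃ n, {η | BadBlock η n 0} := by
    intro η _
    by_cases h : ∃ n, BadBlock η n 0
    · exact Or.inr (mem_iUnion.2 h)
    · push Not at h
      exact Or.inl (inInfiniteCluster_of_good h)
  have hle : (1 : ℝ≥0∞) ≤ 3⁻¹ := by
    calc (1 : ℝ≥0∞) = μ univ := measure_univ.symm
      _ ≤ μ _ + μ _ := (measure_mono hcompl).trans (measure_union_le _ _)
      _ ≤ ∑' n, μ {η | BadBlock η n 0} := by rw [h0, zero_add]; exact measure_iUnion_le _
      _ ≤ ∑' n : ℕ, 4⁻¹ ^ (n + 1) := ENNReal.tsum_le_tsum fun n => measure_badBlock_le hp hμ n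
      _ = 3⁻¹ := by
        have h4 : (1 : ℝ≥0∞) - 4⁻¹ ≠ 0 := (tsub_pos_iff_lt.2 (by simp)).ne'
        rw [ENNReal.tsum_geometric_add_one, ← ENNReal.toReal_eq_toReal_iff'
          (ENNReal.mul_ne_top (by simp) (ENNReal.inv_ne_top.2 h4)) (by simp)]
        rw [ENNReal.toReal_mul, ENNReal.toReal_inv, ENNReal.toReal_inv,
          ENNReal.toReal_sub_of_le (by simp) (by simp), ENNReal.toReal_inv]
        norm_num
  norm_num at hle

lemma pcOf_pos {P : ℝ → Measure (Site → Bool)}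
    (hP : ∀ p ∈ Icc (0 : ℝ) 1, IsBernoulli p (P p)) : 0 < pcOf adjZ2 P := by
  have h : (1 / 8 : ℝ) ∈ Icc (0 : ℝ) 1 := by constructor <;> norm_num
  have : (1 / 8 : ℝ) ≤ pcOf adjZ2 P :=
    le_csSup ⟨1, fun p hp => hp.1.2⟩ ⟨h, theta_eq_zero_of_le le_rfl (hP _ h)⟩
  linarith

lemma pcOf_lt_one {P : ℝ → Measure (Site → Bool)}
    (hP : ∀ p ∈ Icc (0 : ℝ) 1, IsBernoulli p (P p)) : pcOf adjZ2 P < 1 := by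
  have h0 : (0 : ℝ) ∈ Icc (0 : ℝ) 1 := by simp
  have : pcOf adjZ2 P ≤ 323 / 324 := by
    refine csSup_le ⟨0, h0, theta_eq_zero_of_le (by norm_num) (hP _ h0)⟩ fun p hp => ?_
    by_contra! hlt
    exact theta_ne_zero_of_ge hlt.le (hP p hp.1) hp.2
  linarith

/-! ### Comparison of exponents -/

/-- Comparison up to a multiplicative constant does not affect logarithmic asymptotics. -/
lemma tendsto_log_div_of_comparable {ι : Type*} {l : Filter ι} {f g L : ι → ℝ} {C b : ℝ}
    (hC : 1 ≤ C) (h : ∀ᶠ i in l, 0 ≤ f i ∧ f i ≤ g i ∧ g i ≤ C * f i)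
    (hL : Tendsto (fun i => (L i)⁻¹) l (𝓝 0))
    (hf : Tendsto (fun i => Real.log (f i) / L i) l (𝓝 b)) :
    Tendsto (fun i => Real.log (g i) / L i) l (𝓝 b) := by
  have hdiff : Tendsto (fun i => (Real.log (g i) - Real.log (f i)) * (L i)⁻¹) l (𝓝 0) := by
    refine squeeze_zero_norm' (a := fun i => Real.log C * ‖(L i)⁻¹‖) ?_ ?_
    · filter_upwards [h] with i hi
      obtain ⟨h0, h1, h2⟩ := hi
      rw [norm_mul]
      refine mul_le_mul_of_nonneg_right ?_ (norm_nonneg _)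
      rcases h0.eq_or_lt with h0 | h0
      · have hg : g i = 0 := by
          rw [← h0] at h1 h2
          linarith
        rw [hg, ← h0, sub_self, norm_zero]
        exact Real.log_nonneg hC
      · have hlow := Real.log_le_log h0 h1
        have hup := Real.log_le_log (h0.trans_le h1) h2
        rw [Real.log_mul (by linarith) h0.ne'] at hup
        rw [Real.norm_of_nonneg (by linarith)]
        linarith
    · simpa using hL.norm.const_mul (Real.log C)
  refine (hf.add hdiff).congr' ?_ |>.trans (by rw [add_zero])
  exact Eventually.of_forall fun i => by simp only [div_eq_mul_inv]; ring

lemma one_le_inv_pow {p : ℝ} (hp : 0 < p) (hp1 : p ≤ 1) (k : ℕ) : 1 ≤ (p ^ k)⁻¹ :=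
  (one_le_inv₀ (pow_pos hp k)).2 (pow_le_one₀ hp.le hp1)

lemma inv_pow_le_inv_pow {q p : ℝ} (hq : 0 < q) (hqp : q ≤ p) (k : ℕ) :
    (p ^ k)⁻¹ ≤ (q ^ k)⁻¹ :=
  inv_anti₀ (pow_pos hq k) (pow_le_pow_left₀ hq.le hqp k)

lemma tendsto_inv_log_sub_nhdsGT (a : ℝ) :
    Tendsto (fun p => (Real.log (p - a))⁻¹) (𝓝[>] a) (𝓝 0) := by
  refine tendsto_inv_atBot_zero.comp (Real.tendsto_log_nhdsGT_zero.comp ?_)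
  refine tendsto_nhdsWithin_iff.2 ⟨?_, ?_⟩
  · refine Tendsto.mono_left ?_ nhdsWithin_le_nhds
    have : Continuous fun p : ℝ => p - a := by fun_prop
    simpa using this.tendsto a
  · filter_upwards [self_mem_nhdsWithin] with p hp using sub_pos.2 (mem_Ioi.1 hp)

lemma tendsto_inv_log_sub_nhdsLT (a : ℝ) :
    Tendsto (fun p => (Real.log (a - p))⁻¹) (𝓝[<] a) (𝓝 0) := by
  refine tendsto_inv_atBot_zero.comp (Real.tendsto_log_nhdsGT_zero.comp ?_)
  refine tendsto_nhdsWithin_iff.2 ⟨?_, ?_⟩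
  · refine Tendsto.mono_left ?_ nhdsWithin_le_nhds
    have : Continuous fun p : ℝ => a - p := by fun_prop
    simpa using this.tendsto a
  · filter_upwards [self_mem_nhdsWithin] with p hp using sub_pos.2 (mem_Iio.1 hp)

/-- for a monotonic nonessential enhancement of site percolation on
the square lattice `ℤ²` and `s ∈ [0,1]`, the critical exponents `β, η, ν, γ`, if they
exist for the independent process, exist for the enhanced process with the same values. -/
theorem critical_exponents_unchanged_square
    (P : ℝ → Measure (Site → Bool))
    (hP : ∀ p ∈ Icc (0:ℝ) 1, IsBernoulli p (P p))
    (R₀ : ℝ) (φ : Config → Config) (hφ : IsEnhancement R₀ φ)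
    (hmono : Monotonic φ) (hness : ¬ Essential adjZ2 φ)
    (s : ℝ) (hs : s ∈ Icc (0:ℝ) 1) :
    -- (i) the exponent β (percolation probability)
    (∀ β : ℝ,
      Tendsto (fun p => Real.log (theta adjZ2 (P p)) / Real.log (p - pcOf adjZ2 P))
        (𝓝[>] (pcOf adjZ2 P)) (𝓝 β) →
      Tendsto (fun p => Real.log (thetaEnh adjZ2 φ (P p) (P s)) / Real.log (p - pcOf adjZ2 P))
        (𝓝[>] (pcOf adjZ2 P)) (𝓝 β)) ∧
    -- (ii) the exponent η (connectivity function at criticality)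
    (∀ ηexp : ℝ,
      Tendsto (fun x : Site =>
          Real.log (tau adjZ2 (P (pcOf adjZ2 P)) x) / Real.log (siteNorm x))
        (comap siteNorm atTop) (𝓝 (-ηexp)) →
      Tendsto (fun x : Site =>
          Real.log (tauEnh adjZ2 φ (P (pcOf adjZ2 P)) (P s) x) / Real.log (siteNorm x))
        (comap siteNorm atTop) (𝓝 (-ηexp))) ∧
    -- (iii) the exponent ν (correlation length)
    (∀ νexp : ℝ, ∀ ξ : ℝ → ℝ,
      (∀ p : ℝ, 0 < p → p < pcOf adjZ2 P →
        Tendsto (fun x : Site => -Real.log (tau adjZ2 (P p) x) / siteNorm x)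
          (comap siteNorm atTop) (𝓝 (ξ p)⁻¹)) →
      Tendsto (fun p => Real.log (ξ p) / Real.log (pcOf adjZ2 P - p))
        (𝓝[<] (pcOf adjZ2 P)) (𝓝 (-νexp)) →
      ∃ ξ' : ℝ → ℝ,
        (∀ p : ℝ, 0 < p → p < pcOf adjZ2 P →
          Tendsto (fun x : Site => -Real.log (tauEnh adjZ2 φ (P p) (P s) x) / siteNorm x)
            (comap siteNorm atTop) (𝓝 (ξ' p)⁻¹)) ∧
        Tendsto (fun p => Real.log (ξ' p) / Real.log (pcOf adjZ2 P - p))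
          (𝓝[<] (pcOf adjZ2 P)) (𝓝 (-νexp))) ∧
    -- (iv) the exponent γ (mean cluster size)
    (∀ γexp : ℝ,
      Tendsto (fun p => Real.log (chi adjZ2 (P p)).toReal / Real.log (pcOf adjZ2 P - p))
        (𝓝[<] (pcOf adjZ2 P)) (𝓝 (-γexp)) →
      Tendsto (fun p =>
          Real.log (chiEnh adjZ2 φ (P p) (P s)).toReal / Real.log (pcOf adjZ2 P - p))
        (𝓝[<] (pcOf adjZ2 P)) (𝓝 (-γexp))) := by
  have hpc0 : 0 < pcOf adjZ2 P := pcOf_pos hP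
  have hpc1 : pcOf adjZ2 P < 1 := pcOf_lt_one hP
  have hνs : IsProbabilityMeasure (P s) := (hP s hs).1
  obtain ⟨N, hN⟩ := exists_nat_gt R₀
  have bern : ∀ {p : ℝ}, 0 < p → p ≤ 1 → IsBernoulli p (P p) := fun h0 h1 => hP _ ⟨h0.le, h1⟩
  refine ⟨fun β h => ?_, fun ηexp h => ?_, fun νexp ξ hξ h => ⟨ξ, fun p hp hpc => ?_, h⟩,
    fun γexp h => ?_⟩
  · refine tendsto_log_div_of_comparable (one_le_inv_pow hpc0 hpc1.le (comparisonExponent N)) ?_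
      (tendsto_inv_log_sub_nhdsGT _) h
    filter_upwards [Ioo_mem_nhdsGT hpc1] with p hp
    have hp0 : 0 < p := hpc0.trans hp.1
    have hμ := bern hp0 hp.2.le
    refine ⟨ENNReal.toReal_nonneg, theta_le_thetaEnh hμ,
      (thetaEnh_le hφ hmono hness hN hp0 hp.2.le hμ).trans ?_⟩
    exact mul_le_mul_of_nonneg_right (inv_pow_le_inv_pow hpc0 hp.1.le _) ENNReal.toReal_nonneg
  · have hμ := bern hpc0 hpc1.le
    refine tendsto_log_div_of_comparable (one_le_inv_pow hpc0 hpc1.le (comparisonExponent N)) ?_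
      (tendsto_inv_atTop_zero.comp (Real.tendsto_log_atTop.comp tendsto_comap)) h
    exact Eventually.of_forall fun x => ⟨ENNReal.toReal_nonneg, tau_le_tauEnh hμ x,
      tauEnh_le hφ hmono hness hN hpc0 hpc1.le hμ x⟩
  · have hp1 : p ≤ 1 := (hpc.trans hpc1).le
    have hμ := bern hp hp1
    have hlim : Tendsto (fun x : Site => Real.log (tau adjZ2 (P p) x) / siteNorm x)
        (comap siteNorm atTop) (𝓝 (-(ξ p)⁻¹)) := by
      simpa [neg_div] using (hξ p hp hpc).neg
    have key := tendsto_log_div_of_comparable (one_le_inv_pow hp hp1 (comparisonExponent N))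
      (Eventually.of_forall fun x => ⟨ENNReal.toReal_nonneg, tau_le_tauEnh hμ x,
        tauEnh_le (ν := P s) hφ hmono hness hN hp hp1 hμ x⟩)
      (tendsto_inv_atTop_zero.comp tendsto_comap) hlim
    simpa [neg_div] using key.neg
  · have hhalf : 0 < pcOf adjZ2 P / 2 := half_pos hpc0
    refine tendsto_log_div_of_comparable
      (one_le_inv_pow hhalf (by linarith) (comparisonExponent N)) ?_
      (tendsto_inv_log_sub_nhdsLT _) h
    filter_upwards [Ioo_mem_nhdsLT (half_lt_self hpc0)] with p hp
    have hp0 : 0 < p := hhalf.trans hp.1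
    have hp1 : p ≤ 1 := (hp.2.trans hpc1).le
    obtain ⟨h1, h2⟩ := chi_toReal_compare (ν := P s) hφ hmono hness hN hp0 hp1 (bern hp0 hp1)
    exact ⟨ENNReal.toReal_nonneg, h1, h2.trans
      (mul_le_mul_of_nonneg_right (inv_pow_le_inv_pow hhalf hp.1.le _) ENNReal.toReal_nonneg)⟩

end PercEnh
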